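/- arXiv:1603.04145 — 5 statements merged into one kernel-verified Lean document; each statement's English description precedes it below -/
import Mathlib

section
/- The Mordell–Tornheim triple zeta value satisfies ζ_{MT,3}(2,1,1;1) = 2ζ(2)ζ(3) − ζ(5). -/
open scoped BigOperators

/-- The Mordell–Tornheim r-ple zeta value with natural-number exponents. -/
noncomputable def zMTn (r : ℕ) (a : Fin r → ℕ) (c : ℕ) : ℂ :=
  ∑' m : Fin r → ℕ+,
    1 / ((∏ j, ((m j : ℕ) : ℂ) ^ (a j)) * (((∑ j, (m j : ℕ)) : ℕ) : ℂ) ^ c)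

open scoped NNReal ENNReal
open Finset Filter Topology

namespace MT

noncomputable def H (n : ℕ) : ℝ≥0 := ∑ k ∈ range n, 1 / ((k : ℝ≥0) + 1)
noncomputable def H2 (n : ℕ) : ℝ≥0 := ∑ k ∈ range n, 1 / ((k : ℝ≥0) + 1) ^ 2

lemma H_succ (n : ℕ) : H (n + 1) = H n + 1 / ((n : ℝ≥0) + 1) := by
  simp [H, sum_range_succ]

lemma H2_succ (n : ℕ) : H2 (n + 1) = H2 n + 1 / ((n : ℝ≥0) + 1) ^ 2 := by
  simp [H2, sum_range_succ]

lemma tri (F : ℕ → ℕ → ℝ≥0∞) :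
    ∑' n, ∑ k ∈ range (n + 1), F k n = ∑' k, F k k + ∑' k, ∑' j, F k (k + j + 1) := by
  have h1 : ∀ n, ∑ k ∈ range (n + 1), F k n = ∑' k, if k ≤ n then F k n else 0 := by
    intro n
    rw [tsum_eq_sum (s := range (n + 1))]
    · refine sum_congr rfl fun k hk => ?_
      rw [if_pos (by simpa [Nat.lt_succ_iff] using hk)]
    · intro k hk
      rw [if_neg (by simpa [Nat.lt_succ_iff] using hk)]
  simp_rw [h1]
  rw [ENNReal.tsum_comm, ← ENNReal.tsum_add]
  refine tsum_congr fun k => ?_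
  rw [← Summable.sum_add_tsum_nat_add' (f := fun n => if k ≤ n then F k n else 0) (k := k + 1) ENNReal.summable]
  congr 1
  · rw [sum_range_succ, sum_eq_zero]
    · simp
    · intro i hi
      rw [if_neg (by simpa using hi)]
  · refine tsum_congr fun j => ?_
    rw [if_pos (by omega)]
    congr 1
    omega

lemma tele (φ : ℕ → ℝ≥0) (ha : ∀ n, φ (n + 1) ≤ φ n) (h0 : Tendsto φ atTop (𝓝 0)) :
    ∑' k, ((φ k - φ (k + 1) : ℝ≥0) : ℝ≥0∞) = φ 0 := by
  have hs : HasSum (fun k => φ k - φ (k + 1)) (φ 0) := by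
    rw [← NNReal.hasSum_coe, hasSum_iff_tendsto_nat_of_nonneg (fun _ => NNReal.coe_nonneg _)]
    have : ∀ n, ∑ i ∈ range n, ((φ i - φ (i + 1) : ℝ≥0) : ℝ) = (φ 0 : ℝ) - φ n := by
      intro n
      rw [← sum_range_sub' (fun i => (φ i : ℝ))]
      exact sum_congr rfl fun i _ => NNReal.coe_sub (ha i)
    simp_rw [this]
    have h := (NNReal.tendsto_coe.2 h0).const_sub (φ 0 : ℝ)
    simpa using h
  rw [← ENNReal.coe_tsum hs.summable, hs.tsum_eq]

lemma tendsto_inv : Tendsto (fun n : ℕ => 1 / ((n : ℝ≥0) + 1)) atTop (𝓝 0) := by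
  rw [← NNReal.tendsto_coe]
  simpa using tendsto_one_div_add_atTop_nhds_zero_nat (𝕜 := ℝ)

lemma tendsto_H : Tendsto (fun n : ℕ => H n / (n : ℝ≥0)) atTop (𝓝 0) := by
  have h := (NNReal.tendsto_coe.2 tendsto_inv).cesaro
  rw [← NNReal.tendsto_coe]
  refine (h.congr fun n => ?_)
  simp [H, div_eq_inv_mul]

lemma T1 (N : ℕ) : ∑' c : ℕ, (((N : ℝ≥0) / ((c + 1) * (c + 1 + N)) : ℝ≥0) : ℝ≥0∞) = H N := by
  induction N with
  | zero => simp [H]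
  | succ N ih =>
    set φ : ℕ → ℝ≥0 := fun c => 1 / ((c : ℝ≥0) + N + 1) with hφ
    have ha : ∀ n, φ (n + 1) ≤ φ n := by
      intro n
      simp only [hφ]
      push_cast
      gcongr
      simp
    have h0 : Tendsto φ atTop (𝓝 0) := by
      have := (tendsto_add_atTop_iff_nat (f := fun n : ℕ => 1 / ((n : ℝ≥0) + 1)) N).2 tendsto_inv
      simpa [hφ] using this
    have ht := tele φ ha h0
    have hp : ∀ c : ℕ, (((N + 1 : ℕ) : ℝ≥0) / ((c + 1) * (c + 1 + (N + 1 : ℕ))) : ℝ≥0)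
        = (N : ℝ≥0) / ((c + 1) * (c + 1 + N)) + (φ c - φ (c + 1)) := by
      intro c
      have hd : φ c - φ (c + 1) + φ (c + 1) = φ c := tsub_add_cancel_of_le (ha c)
      rw [← add_left_inj (φ (c + 1)), add_assoc (_ / _) (_ - _), hd]
      simp only [hφ]
      push_cast
      field_simp
      ring
    simp_rw [hp, ENNReal.coe_add]
    rw [ENNReal.tsum_add, ih, ht, H_succ]
    simp [hφ]

lemma T1' (n : ℕ) : ∑' c : ℕ, ((1 / (((c : ℝ≥0) + 1) * (c + 1 + (n + 1))) : ℝ≥0) : ℝ≥0∞)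
    = ((H (n + 1) / (n + 1) : ℝ≥0) : ℝ≥0∞) := by
  have h := T1 (n + 1)
  have : ∀ c : ℕ, (1 / (((c : ℝ≥0) + 1) * (c + 1 + (n + 1))) : ℝ≥0)
      = (1 / (n + 1)) * (((n + 1 : ℕ) : ℝ≥0) / ((c + 1) * (c + 1 + (n + 1 : ℕ)))) := by
    intro c
    push_cast
    field_simp
  simp_rw [this, ENNReal.coe_mul]
  rw [ENNReal.tsum_mul_left, h, ← ENNReal.coe_mul]
  congr 1
  field_simp

lemma H_ge (n : ℕ) : (n : ℝ≥0) / (n + 1) ≤ H n := by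
  rcases n with _ | n
  · simp
  · have h1 : (1 : ℝ≥0) ≤ H (n + 1) := by
      unfold H
      refine le_trans ?_ (single_le_sum (f := fun k : ℕ => 1 / ((k : ℝ≥0) + 1)) (fun _ _ => zero_le) (mem_range.2 (Nat.succ_pos n)))
      simp
    refine le_trans ?_ h1
    rw [div_le_one (by positivity)]
    simp

lemma T2 (a : ℕ) : ∑' b : ℕ, (((a : ℝ≥0) * H (a + b + 1) / ((b + 1) * (a + b + 1)) : ℝ≥0) : ℝ≥0∞)
    = ((H a ^ 2 + H2 a : ℝ≥0) : ℝ≥0∞) := by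
  induction a with
  | zero => simp [H, H2]
  | succ a ih =>
    set φ : ℕ → ℝ≥0 := fun b => H (a + b + 1) / ((a : ℝ≥0) + b + 1) with hφ
    have ha : ∀ n, φ (n + 1) ≤ φ n := by
      intro n
      simp only [hφ]
      have h1 := H_ge (a + n + 1)
      rw [show a + (n + 1) + 1 = (a + n + 1) + 1 by ring, H_succ]
      push_cast at h1 ⊢
      generalize H (a + n + 1) = h at *
      rw [div_le_iff₀ (by positivity)] at h1
      rw [div_le_div_iff₀ (by positivity) (by positivity)]
      have e : (h + 1 / ((a : ℝ≥0) + n + 1 + 1)) * (a + n + 1)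
        = h * (a + n + 1) + ((a : ℝ≥0) + n + 1) / (a + n + 1 + 1) := by
        field_simp
      rw [e]
      have : ((a : ℝ≥0) + n + 1) / (a + n + 1 + 1) ≤ h := by
        rw [div_le_iff₀ (by positivity)]; exact h1
      calc _ ≤ h * (a + n + 1) + h := by gcongr
        _ = _ := by ring
    have h0 : Tendsto φ atTop (𝓝 0) := by
      have := (tendsto_add_atTop_iff_nat (a + 1)).2 tendsto_H
      refine this.congr fun n => ?_
      simp only [hφ]
      rw [show n + (a + 1) = a + n + 1 by ring]
      push_cast
      rfl
    have ht := tele φ ha h0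
    have hp : ∀ b : ℕ, (((a + 1 : ℕ) : ℝ≥0) * H (a + 1 + b + 1) / ((b + 1) * ((a + 1 : ℕ) + b + 1)) : ℝ≥0)
        = (a : ℝ≥0) * H (a + b + 1) / ((b + 1) * (a + b + 1)) + 1 / (((b : ℝ≥0) + 1) * (b + 1 + (a + 1)))
          + (φ b - φ (b + 1)) := by
      intro b
      have hd : φ b - φ (b + 1) + φ (b + 1) = φ b := tsub_add_cancel_of_le (ha b)
      rw [← add_left_inj (φ (b + 1)), add_assoc (_ + _) (_ - _), hd]
      simp only [hφ]
      rw [show a + 1 + b + 1 = (a + b + 1) + 1 by ring, show a + (b + 1) + 1 = (a + b + 1) + 1 by ring,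
        H_succ]
      push_cast
      field_simp
      ring
    simp_rw [hp, ENNReal.coe_add]
    rw [ENNReal.tsum_add, ENNReal.tsum_add, ih, ht, T1', ← ENNReal.coe_add, ← ENNReal.coe_add,
      ← ENNReal.coe_add]
    congr 1
    simp only [hφ, H_succ, H2_succ]
    simp only [add_zero]
    push_cast
    field_simp
    ring

lemma T3 (M : ℕ) : ∑' a : ℕ, ((1 / (((a : ℝ≥0) + 1) ^ 2 * (a + 1 + (M + 1))) : ℝ≥0) : ℝ≥0∞)
    + ((H (M + 1) / (M + 1) ^ 2 : ℝ≥0) : ℝ≥0∞)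
    = ((1 / (M + 1) : ℝ≥0) : ℝ≥0∞) * ∑' a : ℕ, ((1 / ((a : ℝ≥0) + 1) ^ 2 : ℝ≥0) : ℝ≥0∞) := by
  have h : ((H (M + 1) / (M + 1) ^ 2 : ℝ≥0) : ℝ≥0∞) = ((1 / (M + 1) : ℝ≥0) : ℝ≥0∞) * ((H (M + 1) / (M + 1) : ℝ≥0) : ℝ≥0∞) := by
    rw [← ENNReal.coe_mul]
    congr 1
    field_simp
  rw [h, ← T1', ← ENNReal.tsum_mul_left, ← ENNReal.tsum_add, ← ENNReal.tsum_mul_left]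
  refine tsum_congr fun a => ?_
  rw [← ENNReal.coe_mul, ← ENNReal.coe_add, ← ENNReal.coe_mul]
  congr 1
  field_simp
  ring

lemma split2 (F : ℕ → ℕ → ℝ≥0∞) :
    ∑' k, ∑' n, F k n = ∑' k, F k k + ∑' k, ∑' j, F k (k + j + 1) + ∑' k, ∑' j, F (k + j + 1) k := by
  rw [← tri, ENNReal.tsum_comm, ← ENNReal.tsum_add]
  refine tsum_congr fun n => ?_
  rw [← Summable.sum_add_tsum_nat_add' (f := fun k => F k n) (k := n + 1) ENNReal.summable]
  congr 1
  refine tsum_congr fun j => ?_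
  congr 1
  omega

noncomputable def z (s : ℕ) : ℝ≥0∞ := ∑' n : ℕ, ((1 / ((n : ℝ≥0) + 1) ^ s : ℝ≥0) : ℝ≥0∞)
noncomputable def dz (s t : ℕ) : ℝ≥0∞ :=
  ∑' k : ℕ, ∑' j : ℕ, ((1 / (((k : ℝ≥0) + j + 2) ^ s * ((k : ℝ≥0) + 1) ^ t) : ℝ≥0) : ℝ≥0∞)

lemma dz_swap (s t : ℕ) : dz s t =
    ∑' k : ℕ, ∑' j : ℕ, ((1 / (((k : ℝ≥0) + j + 2) ^ s * ((j : ℝ≥0) + 1) ^ t) : ℝ≥0) : ℝ≥0∞) := by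
  unfold dz
  rw [ENNReal.tsum_comm]
  refine tsum_congr fun k => tsum_congr fun j => ?_
  rw [add_comm (k : ℝ≥0)]

lemma tri_dz (s t : ℕ) : ∑' n : ℕ, ∑ k ∈ range (n + 1),
    ((1 / (((n : ℝ≥0) + 1) ^ s * ((k : ℝ≥0) + 1) ^ t) : ℝ≥0) : ℝ≥0∞) = z (s + t) + dz s t := by
  rw [tri (fun k n => ((1 / (((n : ℝ≥0) + 1) ^ s * ((k : ℝ≥0) + 1) ^ t) : ℝ≥0) : ℝ≥0∞))]
  unfold z dz
  simp_rw [pow_add]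
  congr 1
  refine tsum_congr fun k => tsum_congr fun j => ?_
  push_cast
  rw [show (k : ℝ≥0) + j + 1 + 1 = k + j + 2 by ring]

lemma sumH (s : ℕ) : ∑' n : ℕ, ((H (n + 1) / ((n : ℝ≥0) + 1) ^ s : ℝ≥0) : ℝ≥0∞) = z (s + 1) + dz s 1 := by
  rw [← tri_dz]
  refine tsum_congr fun n => ?_
  rw [← ENNReal.ofNNReal_finsetSum, H, sum_div]
  congr 1
  refine sum_congr rfl fun k _ => ?_
  field_simp

lemma sumH2 (s : ℕ) : ∑' n : ℕ, ((H2 (n + 1) / ((n : ℝ≥0) + 1) ^ s : ℝ≥0) : ℝ≥0∞) = z (s + 2) + dz s 2 := by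
  rw [← tri_dz]
  refine tsum_congr fun n => ?_
  rw [← ENNReal.ofNNReal_finsetSum, H2, sum_div]
  congr 1
  refine sum_congr rfl fun k _ => ?_
  field_simp

lemma prod_eq : z 2 * z 3 =
    ∑' k : ℕ, ∑' j : ℕ, ((1 / (((k : ℝ≥0) + 1) ^ 2 * ((j : ℝ≥0) + 1) ^ 3) : ℝ≥0) : ℝ≥0∞) := by
  unfold z
  rw [← ENNReal.tsum_mul_right]
  refine tsum_congr fun k => ?_
  rw [← ENNReal.tsum_mul_left]
  refine tsum_congr fun j => ?_
  rw [← ENNReal.coe_mul]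
  congr 1
  field_simp

lemma stuffle : z 2 * z 3 = z 5 + dz 3 2 + dz 2 3 := by
  rw [prod_eq, split2 (fun k j => ((1 / (((k : ℝ≥0) + 1) ^ 2 * ((j : ℝ≥0) + 1) ^ 3) : ℝ≥0) : ℝ≥0∞))]
  unfold z dz
  congr 1
  · congr 1
    · refine tsum_congr fun k => ?_
      rw [← pow_add]
    · refine tsum_congr fun k => tsum_congr fun j => ?_
      push_cast
      rw [show (k : ℝ≥0) + j + 1 + 1 = k + j + 2 by ring, mul_comm]
  · refine tsum_congr fun k => tsum_congr fun j => ?_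
    push_cast
    rw [show (k : ℝ≥0) + j + 1 + 1 = k + j + 2 by ring]

lemma shuffle : z 2 * z 3 = dz 2 3 + 2 * dz 3 2 + 3 * dz 4 1 + dz 3 2 + 3 * dz 4 1 := by
  rw [prod_eq]
  conv_rhs => rw [dz_swap 2 3]; arg 1; arg 1; rw [dz_swap 3 2, dz_swap 4 1]
  unfold dz
  simp_rw [← ENNReal.tsum_mul_left, ← ENNReal.tsum_add]
  refine tsum_congr fun k => tsum_congr fun j => ?_
  rw [show (2 : ℝ≥0∞) = ((2 : ℝ≥0) : ℝ≥0∞) by simp, show (3 : ℝ≥0∞) = ((3 : ℝ≥0) : ℝ≥0∞) by simp]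
  simp_rw [← ENNReal.coe_mul, ← ENNReal.coe_add]
  congr 1
  field_simp
  ring

lemma sumForm : z 5 + dz 4 1 = dz 2 3 + dz 3 2 + dz 4 1 + dz 4 1 := by
  rw [← sumH]
  conv_rhs => arg 2; rw [dz_swap 4 1]
  unfold dz
  simp_rw [← ENNReal.tsum_add]
  refine tsum_congr fun k => ?_
  have h : ((H (k + 1) / (k + 1) ^ 4 : ℝ≥0) : ℝ≥0∞) = ((1 / (k + 1) ^ 3 : ℝ≥0) : ℝ≥0∞) * ((H (k + 1) / (k + 1) : ℝ≥0) : ℝ≥0∞) := by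
    rw [← ENNReal.coe_mul]
    congr 1
    field_simp
  rw [h, ← T1', ← ENNReal.tsum_mul_left]
  refine tsum_congr fun j => ?_
  simp_rw [← ENNReal.coe_mul, ← ENNReal.coe_add]
  congr 1
  field_simp
  ring

noncomputable def Y : ℝ≥0∞ := ∑' b : ℕ, ∑' c : ℕ,
  ((1 / (((b : ℝ≥0) + 1) * (c + 1) * (b + c + 2)) : ℝ≥0) : ℝ≥0∞)

lemma Y1 : Y = z 3 + dz 2 1 := by
  rw [← sumH, Y]
  refine tsum_congr fun k => ?_
  have h : ((H (k + 1) / (k + 1) ^ 2 : ℝ≥0) : ℝ≥0∞) = ((1 / (k + 1) : ℝ≥0) : ℝ≥0∞) * ((H (k + 1) / (k + 1) : ℝ≥0) : ℝ≥0∞) := by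
    rw [← ENNReal.coe_mul]
    congr 1
    field_simp
  rw [h, ← T1', ← ENNReal.tsum_mul_left]
  refine tsum_congr fun j => ?_
  simp_rw [← ENNReal.coe_mul]
  congr 1
  field_simp
  ring

lemma Y2 : Y = dz 2 1 + dz 2 1 := by
  conv_rhs => arg 2; rw [dz_swap]
  rw [Y, dz]
  simp_rw [← ENNReal.tsum_add]
  refine tsum_congr fun k => tsum_congr fun j => ?_
  simp_rw [← ENNReal.coe_add]
  congr 1
  field_simp
  ring

lemma Y_fin : Y ≠ ⊤ := by
  have hs : Summable (fun n : ℕ => ((n : ℝ≥0) + 1) ^ (-(3 / 2) : ℝ)) := by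
    have h := (NNReal.summable_nat_add_iff 1).2 (NNReal.summable_rpow.2 (show (-(3 / 2) : ℝ) < -1 by norm_num))
    simpa using h
  have ht : ∑' n : ℕ, ((((n : ℝ≥0) + 1) ^ (-(3 / 2) : ℝ) : ℝ≥0) : ℝ≥0∞) ≠ ⊤ :=
    ENNReal.tsum_coe_ne_top_iff_summable.2 hs
  refine ne_top_of_le_ne_top (ENNReal.mul_ne_top ht ht) ?_
  rw [← ENNReal.tsum_mul_right, Y]
  refine ENNReal.tsum_le_tsum fun b => ?_
  rw [← ENNReal.tsum_mul_left]
  refine ENNReal.tsum_le_tsum fun c => ?_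
  rw [← ENNReal.coe_mul, ENNReal.coe_le_coe]
  have hx : ∀ x : ℝ≥0, 0 < x → x ^ (-(3 / 2) : ℝ) = 1 / (x * NNReal.sqrt x) := by
    intro x hx
    rw [NNReal.rpow_neg, show (3 / 2 : ℝ) = 1 + 1 / 2 by norm_num, NNReal.rpow_add hx.ne', NNReal.rpow_one,
      ← NNReal.sqrt_eq_rpow, one_div]
  rw [hx _ (by positivity), hx _ (by positivity), div_mul_div_comm, one_mul]
  have h1 : 0 < NNReal.sqrt ((b : ℝ≥0) + 1) := NNReal.sqrt_pos.2 (by positivity)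
  have h2 : 0 < NNReal.sqrt ((c : ℝ≥0) + 1) := NNReal.sqrt_pos.2 (by positivity)
  refine one_div_le_one_div_of_le (by positivity) ?_
  have key : NNReal.sqrt ((b : ℝ≥0) + 1) * NNReal.sqrt ((c : ℝ≥0) + 1) ≤ b + c + 2 := by
    have e1 := NNReal.sq_sqrt ((b : ℝ≥0) + 1)
    have e2 := NNReal.sq_sqrt ((c : ℝ≥0) + 1)
    generalize NNReal.sqrt ((b : ℝ≥0) + 1) = x at *
    generalize NNReal.sqrt ((c : ℝ≥0) + 1) = y at *
    have : (b : ℝ≥0) + c + 2 = x ^ 2 + y ^ 2 := by rw [e1, e2]; ring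
    rw [this, ← NNReal.coe_le_coe]
    push_cast
    nlinarith [sq_nonneg ((x : ℝ) - y), sq_nonneg (x : ℝ), sq_nonneg (y : ℝ)]
  calc _ = (((b : ℝ≥0) + 1) * (c + 1)) * (NNReal.sqrt ((b : ℝ≥0) + 1) * NNReal.sqrt ((c : ℝ≥0) + 1)) := by ring
    _ ≤ _ := by gcongr

lemma Y3 : Y = 2 * z 3 := by
  have hf := Y_fin
  have h1 := Y1
  have h2 := Y2
  have hd : dz 2 1 ≠ ⊤ := by
    intro h
    rw [h] at h2
    simp [h2] at hf
  have : z 3 = dz 2 1 := by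
    rw [h1] at h2
    exact (ENNReal.add_left_inj hd).1 h2
  rw [h2, this, two_mul]

noncomputable def S : ℝ≥0∞ := ∑' a : ℕ, ∑' b : ℕ, ∑' c : ℕ,
  ((1 / (((a : ℝ≥0) + 1) ^ 2 * (b + 1) * (c + 1) * (a + b + c + 3)) : ℝ≥0) : ℝ≥0∞)

noncomputable def A : ℝ≥0∞ := ∑' n : ℕ, ((H (n + 1) ^ 2 / ((n : ℝ≥0) + 1) ^ 3 : ℝ≥0) : ℝ≥0∞)

noncomputable def X : ℝ≥0∞ := ∑' b : ℕ, ∑' c : ℕ,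
  ((H (b + c + 2) / (((b : ℝ≥0) + 1) * (c + 1) * (b + c + 2) ^ 2) : ℝ≥0) : ℝ≥0∞)

lemma S1 : S = A + (z 5 + dz 3 2) := by
  rw [← sumH2, S, A, ← ENNReal.tsum_add]
  refine tsum_congr fun a => ?_
  have h : ((H (a + 1) ^ 2 / (a + 1) ^ 3 : ℝ≥0) : ℝ≥0∞) + ((H2 (a + 1) / (a + 1) ^ 3 : ℝ≥0) : ℝ≥0∞)
      = ((1 / (a + 1) ^ 3 : ℝ≥0) : ℝ≥0∞) * ((H (a + 1) ^ 2 + H2 (a + 1) : ℝ≥0) : ℝ≥0∞) := by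
    rw [← ENNReal.coe_mul, ← ENNReal.coe_add]
    congr 1
    field_simp
  rw [h, ← T2, ← ENNReal.tsum_mul_left]
  refine tsum_congr fun b => ?_
  have h : ((1 / (a + 1) ^ 3 : ℝ≥0) : ℝ≥0∞) * (((a + 1 : ℕ) * H (a + 1 + b + 1) / ((b + 1) * ((a + 1 : ℕ) + b + 1)) : ℝ≥0) : ℝ≥0∞)
      = ((1 / ((a + 1) ^ 2 * (b + 1)) : ℝ≥0) : ℝ≥0∞) * ((H (a + 1 + b + 1) / ((a + 1 + b : ℕ) + 1) : ℝ≥0) : ℝ≥0∞) := by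
    rw [← ENNReal.coe_mul, ← ENNReal.coe_mul]
    congr 1
    push_cast
    field_simp
  rw [h, ← T1', ← ENNReal.tsum_mul_left]
  refine tsum_congr fun c => ?_
  rw [← ENNReal.coe_mul]
  congr 1
  push_cast
  field_simp
  ring

lemma S2 : S + X = z 2 * Y := by
  have hS : S = ∑' b : ℕ, ∑' c : ℕ, ∑' a : ℕ,
      ((1 / (((a : ℝ≥0) + 1) ^ 2 * (b + 1) * (c + 1) * (a + b + c + 3)) : ℝ≥0) : ℝ≥0∞) := by
    rw [S, ENNReal.tsum_comm]
    refine tsum_congr fun b => ?_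
    rw [ENNReal.tsum_comm]
  rw [hS, X, Y, ← ENNReal.tsum_add, ← ENNReal.tsum_mul_left]
  refine tsum_congr fun b => ?_
  rw [← ENNReal.tsum_add, ← ENNReal.tsum_mul_left]
  refine tsum_congr fun c => ?_
  have h := congrArg (fun x => ((1 / ((b + 1) * (c + 1)) : ℝ≥0) : ℝ≥0∞) * x) (T3 (b + c + 1))
  rw [mul_add _ (∑' _, _), ← ENNReal.tsum_mul_left, ← ENNReal.coe_mul _ (_ / _), ← mul_assoc, ← ENNReal.coe_mul] at h
  simp_rw [← ENNReal.coe_mul] at h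
  convert h using 1
  · congr 1
    · refine tsum_congr fun a => ?_
      congr 1
      push_cast
      field_simp
      ring
    · congr 1
      push_cast
      field_simp
      ring
  · rw [z, mul_comm]
    congr 2
    push_cast
    field_simp
    ring

lemma X1 : X + 2 * (z 5 + dz 4 1) = 2 * A := by
  set G : ℝ≥0∞ := ∑' k : ℕ, ∑' j : ℕ, ((H (k + j + 2) / (((k : ℝ≥0) + 1) * (k + j + 2) ^ 3) : ℝ≥0) : ℝ≥0∞) with hG
  have hA : A = z 5 + dz 4 1 + G := by
    rw [← sumH]
    have h := tri (fun k n => ((H (n + 1) / (((k : ℝ≥0) + 1) * (n + 1) ^ 3) : ℝ≥0) : ℝ≥0∞))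
    convert h using 1
    · refine tsum_congr fun n => ?_
      rw [← ENNReal.ofNNReal_finsetSum]
      congr 1
      rw [sq]
      nth_rw 1 [H]
      rw [sum_mul, sum_div]
      refine sum_congr rfl fun k _ => ?_
      field_simp
    · congr 1
      · refine tsum_congr fun n => ?_
        congr 1
        field_simp
      · refine tsum_congr fun k => tsum_congr fun j => ?_
        congr 1
        push_cast
        rw [show (k : ℝ≥0) + j + 1 + 1 = k + j + 2 by ring]
  have hX : X = G + G := by
    have hG' : G = ∑' k : ℕ, ∑' j : ℕ, ((H (k + j + 2) / (((j : ℝ≥0) + 1) * (k + j + 2) ^ 3) : ℝ≥0) : ℝ≥0∞) := by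
      rw [hG, ENNReal.tsum_comm]
      refine tsum_congr fun k => tsum_congr fun j => ?_
      rw [add_comm (k : ℝ≥0), add_comm k]
    conv_rhs => arg 2; rw [hG']
    rw [hG, X]
    simp_rw [← ENNReal.tsum_add]
    refine tsum_congr fun k => tsum_congr fun j => ?_
    simp_rw [← ENNReal.coe_add]
    congr 1
    field_simp
    ring
  rw [hX, hA]
  ring

lemma z_fin (s : ℕ) (hs : 1 < s) : z s ≠ ⊤ := by
  refine ENNReal.tsum_coe_ne_top_iff_summable.2 ?_
  have h := (NNReal.summable_nat_add_iff 1).2 (NNReal.summable_rpow_inv.2 (show (1 : ℝ) < s by exact_mod_cast hs))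
  simpa using h

lemma final (p2 p3 p5 s x a d32 d23 d41 : ℝ≥0∞) (f2 : p2 ≠ ⊤) (f3 : p3 ≠ ⊤) (f5 : p5 ≠ ⊤)
    (fS : s ≠ ⊤) (fX : x ≠ ⊤) (fA : a ≠ ⊤) (f32 : d32 ≠ ⊤) (f23 : d23 ≠ ⊤) (f41 : d41 ≠ ⊤)
    (h1 : p2 * p3 = p5 + d32 + d23)
    (h2 : p2 * p3 = d23 + 2 * d32 + 3 * d41 + d32 + 3 * d41)
    (h3 : p5 + d41 = d23 + d32 + d41 + d41)
    (h4 : s = a + (p5 + d32))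
    (h5 : s + x = p2 * (2 * p3))
    (h6 : x + 2 * (p5 + d41) = 2 * a) :
    s.toReal = 2 * p2.toReal * p3.toReal - p5.toReal := by
  lift p2 to ℝ≥0 using f2
  lift p3 to ℝ≥0 using f3
  lift p5 to ℝ≥0 using f5
  lift s to ℝ≥0 using fS
  lift x to ℝ≥0 using fX
  lift a to ℝ≥0 using fA
  lift d32 to ℝ≥0 using f32
  lift d23 to ℝ≥0 using f23
  lift d41 to ℝ≥0 using f41
  norm_cast at h1 h2 h3 h4 h5 h6
  simp only [ENNReal.coe_toReal]
  rw [← NNReal.coe_inj] at h1 h2 h3 h4 h5 h6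
  push_cast at h1 h2 h3 h4 h5 h6
  linarith

lemma S_val : (S).toReal = 2 * (z 2).toReal * (z 3).toReal - (z 5).toReal := by
  have f2 := z_fin 2 (by norm_num)
  have f3 := z_fin 3 (by norm_num)
  have f5 := z_fin 5 (by norm_num)
  have hP := ENNReal.mul_ne_top f2 f3
  have h1 := stuffle
  have h2 := shuffle
  have h3 := sumForm
  have h4 := S1
  have h5 := S2
  have h6 := X1
  rw [Y3] at h5
  have hq : z 2 * (2 * z 3) ≠ ⊤ := ENNReal.mul_ne_top f2 (ENNReal.mul_ne_top (by simp) f3)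
  have fSX := hq
  rw [← h5] at fSX
  have ⟨fS, fX⟩ := ENNReal.add_ne_top.1 fSX
  have fA : A ≠ ⊤ := by
    intro h; rw [h] at h4; simp [h4] at fS
  have fst := hP
  rw [h1] at fst
  have fsh := hP
  rw [h2] at fsh
  have f32 : dz 3 2 ≠ ⊤ := by
    intro h; simp [h] at fst
  have f23 : dz 2 3 ≠ ⊤ := by
    intro h; simp [h] at fst
  have f41 : dz 4 1 ≠ ⊤ := by
    intro h; simp [h] at fsh
  exact final _ _ _ _ _ _ _ _ _ f2 f3 f5 fS fX fA f32 f23 f41 h1 h2 h3 h4 h5 h6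

lemma z_zeta (s : ℕ) (hs : 1 < s) : riemannZeta s = (((z s).toReal : ℝ) : ℂ) := by
  rw [zeta_eq_tsum_one_div_nat_add_one_cpow (by simpa using hs), z, ENNReal.tsum_toReal_eq (fun _ => by simp),
    Complex.ofReal_tsum]
  refine tsum_congr fun n => ?_
  rw [ENNReal.coe_toReal]
  push_cast
  simp

end MT

theorem stmt_3 :
    zMTn 3 ![2, 1, 1] 1 = 2 * riemannZeta 2 * riemannZeta 3 - riemannZeta 5 := by
  have h2 := MT.z_zeta 2 (by norm_num)
  have h3 := MT.z_zeta 3 (by norm_num)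
  have h5 := MT.z_zeta 5 (by norm_num)
  push_cast at h2 h3 h5
  rw [h2, h3, h5]
  have hv := congrArg (fun x : ℝ => (x : ℂ)) MT.S_val
  push_cast at hv
  rw [← hv, zMTn]
  let eq3 : ℕ × ℕ × ℕ ≃ (Fin 3 → ℕ+) :=
    { toFun := fun p => ![p.1.succPNat, p.2.1.succPNat, p.2.2.succPNat]
      invFun := fun m => ((m 0).natPred, (m 1).natPred, (m 2).natPred)
      left_inv := fun p => by simp
      right_inv := fun m => by
        ext i
        fin_cases i <;> simp }
  have hS : MT.S = ∑' p : ℕ × ℕ × ℕ,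
    ((1 / (((p.1 : ℝ≥0) + 1) ^ 2 * (p.2.1 + 1) * (p.2.2 + 1) * (p.1 + p.2.1 + p.2.2 + 3)) : ℝ≥0) : ℝ≥0∞) := by
    rw [MT.S, ENNReal.tsum_prod']
    refine tsum_congr fun a => ?_
    rw [ENNReal.tsum_prod']
  rw [hS, ENNReal.tsum_toReal_eq (fun _ => ENNReal.coe_ne_top), Complex.ofReal_tsum, ← eq3.tsum_eq]
  refine tsum_congr fun p => ?_
  simp only [eq3, Equiv.coe_fn_mk, Fin.prod_univ_three, Fin.sum_univ_three]
  rw [ENNReal.coe_toReal]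
  push_cast
  simp
  left
  ring
end

section
/- The Mordell–Tornheim 5-fold zeta value satisfies ζ_{MT,5}(2,1,1,1,1;1) = 4!·(ζ(2)ζ(5) + 3ζ(3)ζ(4) − 4ζ(7)). -/
open scoped BigOperators

open scoped ENNReal NNReal

noncomputable def iv (n : ℕ) : ℝ≥0∞ := (((n : ℝ≥0)⁻¹ : ℝ≥0) : ℝ≥0∞)

noncomputable def TT (F : ℕ → ℝ≥0∞) (n : ℕ) : ℝ≥0∞ := ∑' b : ℕ+, F (n + b) * iv (n + b)

noncomputable def PP (r : ℕ) (F : ℕ → ℝ≥0∞) : ℝ≥0∞ :=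
  ∑' a : Fin r → ℕ+, F (∑ j, (a j : ℕ)) * ∏ j, iv (a j)

lemma PP_zero (F : ℕ → ℝ≥0∞) : PP 0 F = F 0 := by
  simp [PP]

lemma PP_cons (r : ℕ) (F : ℕ → ℝ≥0∞) :
    PP (r + 1) F = ∑' b : ℕ+, iv b * PP r (fun n => F (n + b)) := by
  unfold PP
  rw [← (Fin.consEquiv (fun _ : Fin (r+1) => ℕ+)).tsum_eq, ENNReal.summable.tsum_prod' (fun _ => ENNReal.summable)]
  refine tsum_congr fun b => ?_
  rw [← ENNReal.tsum_mul_left]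
  refine tsum_congr fun a => ?_
  simp only [Fin.consEquiv_apply, Fin.sum_univ_succ, Fin.prod_univ_succ, Fin.cons_zero,
    Fin.cons_succ]
  rw [add_comm (b : ℕ)]
  ring

lemma iv_mul (n : ℕ) (hn : n ≠ 0) : (n : ℝ≥0∞) * iv n = 1 := by
  have : (n : ℝ≥0) ≠ 0 := by exact_mod_cast hn
  have h : (n : ℝ≥0) * (n : ℝ≥0)⁻¹ = 1 := mul_inv_cancel₀ this
  unfold iv
  exact_mod_cast h

lemma PP_succ (r : ℕ) (F : ℕ → ℝ≥0∞) :
    PP (r + 1) F = (r + 1 : ℕ) * PP r (TT F) := by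
  have key : ∀ a : Fin (r+1) → ℕ+, F (∑ j, (a j : ℕ)) * ∏ j, iv (a j) =
      ∑ i, F (∑ j, (a j : ℕ)) * iv (∑ j, (a j : ℕ)) * ∏ j, iv (a (Fin.succAbove i j)) := by
    intro a
    have h0 : (∑ j, (a j : ℕ)) ≠ 0 := by
      rw [Fin.sum_univ_succ]
      have := (a 0).pos
      omega
    have h1 : ∀ i, ∏ j, iv (a (Fin.succAbove i j)) = (a i : ℕ) * ∏ j, iv (a j) := by
      intro i
      rw [Fin.prod_univ_succAbove _ i, ← mul_assoc, iv_mul _ (a i).pos.ne', one_mul]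
    simp_rw [h1, ← mul_assoc]
    rw [← Finset.sum_mul, ← Finset.mul_sum, ← Nat.cast_sum, mul_assoc (F _), mul_comm (iv _),
      iv_mul _ h0, mul_one]
  have key2 : ∀ i : Fin (r+1), ∑' a : Fin (r+1) → ℕ+,
      F (∑ j, (a j : ℕ)) * iv (∑ j, (a j : ℕ)) * ∏ j, iv (a (Fin.succAbove i j)) = PP r (TT F) := by
    intro i
    rw [← (Fin.insertNthEquiv (fun _ : Fin (r+1) => ℕ+) i).tsum_eq, ENNReal.summable.tsum_prod' (fun _ => ENNReal.summable),
      ENNReal.tsum_comm]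
    unfold PP TT
    refine tsum_congr fun a => ?_
    rw [← ENNReal.tsum_mul_right]
    refine tsum_congr fun b => ?_
    simp only [Fin.insertNthEquiv_apply, Fin.sum_univ_succAbove _ i, Fin.insertNth_apply_same,
      Fin.insertNth_apply_succAbove]
    rw [add_comm (b : ℕ)]
  unfold PP at *
  simp_rw [key]
  rw [Summable.tsum_finsetSum (fun _ _ => ENNReal.summable)]
  simp_rw [key2]
  simp

noncomputable def CC (m n : ℕ) : ℝ≥0∞ :=
  (((m.factorial * n.factorial : ℝ≥0) / (m + n).factorial : ℝ≥0) : ℝ≥0∞)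

lemma CC_comm (m n : ℕ) : CC m n = CC n m := by
  unfold CC; rw [mul_comm, add_comm]

lemma CC_zero (m : ℕ) : CC m 0 = 1 := by
  unfold CC
  have : (m.factorial : ℝ≥0) ≠ 0 := by exact_mod_cast m.factorial_ne_zero
  simp [this]

lemma CC_step (m q : ℕ) (hm : m ≠ 0) :
    CC m (q + 1) * iv (q + 1) + CC m (q + 1) * iv m = CC m q * iv m := by
  unfold CC iv
  norm_cast
  rw [← add_assoc, Nat.factorial_succ, Nat.factorial_succ]
  have h1 : ((m+q).factorial : ℝ≥0) ≠ 0 := by exact_mod_cast (m+q).factorial_ne_zero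
  have h2 : (m : ℝ≥0) ≠ 0 := by exact_mod_cast hm
  push_cast
  field_simp
  ring

lemma CC_le (m q : ℕ) (hm : m ≠ 0) : CC m q ≤ iv (q + 1) := by
  obtain ⟨m, rfl⟩ := Nat.exists_eq_succ_of_ne_zero hm
  clear hm
  unfold CC iv
  norm_cast
  have h : (m+1).factorial * q.factorial * (q+1) ≤ (m + 1 + q).factorial := by
    have := Nat.le_of_dvd (Nat.factorial_pos _) (Nat.factorial_mul_factorial_dvd_factorial_add m (q+1))
    induction m with
    | zero => simp [Nat.factorial_succ, Nat.add_comm 1 q]; nlinarith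
    | succ m ih =>
      have ih := ih (Nat.le_of_dvd (Nat.factorial_pos _) (Nat.factorial_mul_factorial_dvd_factorial_add m (q+1)))
      rw [show m + 1 + 1 + q = (m + 1 + q) + 1 by ring, Nat.factorial_succ (m+1), Nat.factorial_succ (m+1+q)]
      calc _ = (m+1+1) * ((m+1).factorial * q.factorial * (q+1)) := by ring
        _ ≤ _ := Nat.mul_le_mul (by omega) ih
  have h1 : ((m + 1 + q).factorial : ℝ≥0) ≠ 0 := by exact_mod_cast Nat.factorial_ne_zero _
  rw [div_le_iff₀ (by positivity)]
  rw [inv_mul_eq_div, le_div_iff₀ (by positivity)]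
  exact_mod_cast h

lemma TT_CC (m : ℕ) (hm : m ≠ 0) (n : ℕ) : TT (CC m) n = CC m n * iv m := by
  unfold TT
  rw [tsum_pnat_eq_tsum_succ (f := fun b => CC m (n + b) * iv (n + b))]
  have hs : ∀ N, ∑ b ∈ Finset.range N, CC m (n + (b+1)) * iv (n + (b+1)) + CC m (n + N) * iv m
      = CC m n * iv m := by
    intro N
    induction N with
    | zero => simp
    | succ N ih => rw [Finset.sum_range_succ, add_assoc]; rw [← add_assoc n N 1, CC_step _ _ hm, ih]
  have ht := (ENNReal.tendsto_nat_tsum (fun b => CC m (n + (b+1)) * iv (n + (b+1))))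
  have hz : Filter.Tendsto (fun N => CC m (n + N) * iv m) Filter.atTop (nhds 0) := by
    have h0 : Filter.Tendsto (fun N : ℕ => iv (n + N + 1) * iv m) Filter.atTop (nhds 0) := by
      unfold iv
      have : Filter.Tendsto (fun N : ℕ => (((n + N + 1 : ℕ) : ℝ≥0)⁻¹ * (m:ℝ≥0)⁻¹)) Filter.atTop (nhds (0 * (m:ℝ≥0)⁻¹)) := by
        apply Filter.Tendsto.mul_const
        apply Filter.Tendsto.comp tendsto_inv_atTop_nhds_zero_nat
        apply Filter.tendsto_atTop_mono (f := id) _ Filter.tendsto_id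
        intro N; simp; omega
      rw [zero_mul] at this
      simpa only [ENNReal.coe_mul, ENNReal.coe_zero] using ENNReal.tendsto_coe.2 this
    exact tendsto_of_tendsto_of_tendsto_of_le_of_le tendsto_const_nhds h0 (fun _ => zero_le)
      (fun N => mul_le_mul_left (CC_le m _ hm) _)
  have := ht.add hz
  simp_rw [hs] at this
  rw [add_zero] at this
  exact tendsto_nhds_unique this tendsto_const_nhds

/-- symmetric form -/
lemma tsum_CC (b n : ℕ) (hn : n ≠ 0) : ∑' k : ℕ+, iv (b + k) * CC (b + k) n = CC b n * iv n := by
  rw [CC_comm, ← TT_CC n hn b]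
  unfold TT
  exact tsum_congr fun k => by rw [CC_comm, mul_comm]

lemma iv_eq (n : ℕ) (hn : n ≠ 0) : iv n = ∑' m : ℕ+, iv m * CC m n := by
  have := tsum_CC 0 n hn
  rw [CC_comm, CC_zero, one_mul] at this
  simpa using this.symm


lemma TT_congr {F G : ℕ → ℝ≥0∞} (h : ∀ n, n ≠ 0 → F n = G n) : TT F = TT G := by
  funext n
  unfold TT
  refine tsum_congr fun b => ?_
  rw [h _ (by have := b.pos; omega)]

lemma TT_tsum {ι : Type*} (f : ι → ℕ → ℝ≥0∞) (n : ℕ) :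
    TT (fun n => ∑' x, f x n) n = ∑' x, TT (f x) n := by
  unfold TT
  rw [ENNReal.tsum_comm]
  exact tsum_congr fun b => ENNReal.tsum_mul_right.symm

lemma TT_const_mul (c : ℝ≥0∞) (f : ℕ → ℝ≥0∞) (n : ℕ) :
    TT (fun n => c * f n) n = c * TT f n := by
  unfold TT
  rw [← ENNReal.tsum_mul_left]
  exact tsum_congr fun b => mul_assoc _ _ _

lemma TT_iter {ι : Type*} (c : ι → ℝ≥0∞) (φ : ι → ℕ) (hφ : ∀ x, φ x ≠ 0) (k : ℕ) :
    TT^[k] (fun n => ∑' x, c x * CC (φ x) n) = fun n => ∑' x, c x * iv (φ x) ^ k * CC (φ x) n := by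
  induction k with
  | zero => simp
  | succ k ih =>
    rw [Function.iterate_succ_apply', ih]
    funext n
    rw [TT_tsum]
    refine tsum_congr fun x => ?_
    rw [TT_const_mul, TT_CC _ (hφ x)]
    ring

lemma TT_iter_zero {ι : Type*} (c : ι → ℝ≥0∞) (φ : ι → ℕ) (hφ : ∀ x, φ x ≠ 0)
    (F : ℕ → ℝ≥0∞) (hF : ∀ n, n ≠ 0 → F n = ∑' x, c x * CC (φ x) n) (k : ℕ) :
    TT^[k + 1] F 0 = ∑' x, c x * iv (φ x) ^ (k + 1) := by
  rw [Function.iterate_succ_apply, TT_congr hF, ← Function.iterate_succ_apply, TT_iter c φ hφ]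
  simp [CC_zero]

lemma PP_iter (r : ℕ) (F : ℕ → ℝ≥0∞) : PP r F = (r.factorial : ℝ≥0∞) * TT^[r] F 0 := by
  induction r generalizing F with
  | zero => simp [PP_zero]
  | succ r ih =>
    rw [PP_succ, ih, Function.iterate_succ_apply, Nat.factorial_succ]
    push_cast
    ring

noncomputable def ZZ (k : ℕ) : ℝ≥0∞ := ∑' n : ℕ+, iv n ^ k

noncomputable def DD (s t : ℕ) : ℝ≥0∞ :=
  ∑' p : ℕ+ × ℕ+, iv ((p.1 : ℕ) + p.2) ^ s * iv p.1 ^ t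

lemma V1 : TT^[4] iv 0 = ZZ 5 := by
  rw [TT_iter_zero (fun m : ℕ+ => iv m) (fun m : ℕ+ => (m : ℕ)) (fun m => m.pos.ne') iv
    (fun n hn => iv_eq n hn) 3]
  exact tsum_congr fun m => by ring

lemma TT_iv (n : ℕ) : TT iv n = ∑' b : ℕ+, iv b ^ 2 * CC b n := by
  have := congrFun (TT_congr (fun n hn => iv_eq n hn)) n
  rw [this, TT_tsum]
  refine tsum_congr fun b => ?_
  rw [TT_const_mul, TT_CC _ b.pos.ne']
  ring

lemma expand (c : ℕ+ → ℝ≥0∞) (n : ℕ) (hn : n ≠ 0) :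
    iv n * ∑' b : ℕ+, c b * CC b n =
      ∑' p : ℕ+ × ℕ+, (c p.1 * iv ((p.1 : ℕ) + p.2)) * CC ((p.1 : ℕ) + p.2) n := by
  rw [ENNReal.summable.tsum_prod' (fun _ => ENNReal.summable), ← ENNReal.tsum_mul_left]
  refine tsum_congr fun b => ?_
  simp_rw [mul_assoc]
  rw [ENNReal.tsum_mul_left, tsum_CC _ _ hn]
  ring

lemma V2 : TT^[4] (fun n => iv n * TT iv n) 0 = DD 5 2 := by
  rw [TT_iter_zero (fun p : ℕ+ × ℕ+ => iv p.1 ^ 2 * iv ((p.1 : ℕ) + p.2))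
    (fun p => (p.1 : ℕ) + p.2) (fun p => by have := p.1.pos; omega) _
    (fun n hn => by rw [TT_iv, expand _ _ hn]) 3]
  exact tsum_congr fun m => by ring

lemma V3 : TT^[5] (fun n => iv n ^ 2) 0 = DD 6 1 := by
  rw [TT_iter_zero (fun p : ℕ+ × ℕ+ => iv p.1 * iv ((p.1 : ℕ) + p.2))
    (fun p => (p.1 : ℕ) + p.2) (fun p => by have := p.1.pos; omega) _
    (fun n hn => by rw [sq]; nth_rw 2 [iv_eq n hn]; rw [expand _ _ hn]) 4]
  exact tsum_congr fun m => by ring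

noncomputable def FS (n : ℕ) : ℝ≥0∞ := ∑' m : ℕ+, iv m ^ 2 * iv (m + n)

lemma pf (m M : ℕ) (hm : m ≠ 0) (hM : M ≠ 0) :
    iv m ^ 2 * iv (m + M) * iv M + iv M * iv M * iv (M + m) ^ 2 + iv M * iv (M + m) ^ 3 +
      iv m * iv (M + m) ^ 3 = iv m ^ 2 * (iv M * iv M) := by
  unfold iv
  norm_cast
  have h2 : (m : ℝ≥0) ≠ 0 := by exact_mod_cast hm
  have h3 : (M : ℝ≥0) ≠ 0 := by exact_mod_cast hM
  push_cast
  rw [add_comm (m : ℝ≥0) M]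
  have h4 : (M + m : ℝ≥0) ≠ 0 := by positivity
  field_simp
  ring

lemma main1 (M : ℕ) (hM : M ≠ 0) :
    FS M * iv M + (iv M * TT iv M) * iv M + TT (fun n => iv n ^ 2) M * iv M +
      ∑' m : ℕ+, iv m * iv (M + m) ^ 3 = ZZ 2 * (iv M * iv M) := by
  unfold FS TT ZZ
  rw [← ENNReal.tsum_mul_right, ← ENNReal.tsum_mul_right, ← ENNReal.tsum_mul_left,
    ← ENNReal.tsum_mul_right, ← ENNReal.tsum_mul_right, ← ENNReal.tsum_add, ← ENNReal.tsum_add,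
    ← ENNReal.tsum_add]
  refine tsum_congr fun m => ?_
  rw [← pf m M m.pos.ne' hM]
  ring

lemma main2 (n : ℕ) :
    TT FS n + TT (fun n => iv n * TT iv n) n + TT (TT (fun n => iv n ^ 2)) n +
      ∑' m : ℕ+, iv m * TT (fun n => iv n ^ 2) (n + m) = ZZ 2 * TT iv n := by
  have hW : ∑' m : ℕ+, iv m * TT (fun n => iv n ^ 2) (n + m) =
      ∑' b : ℕ+, ∑' m : ℕ+, iv m * iv (n + b + m) ^ 3 := by
    rw [ENNReal.tsum_comm]
    refine tsum_congr fun m => ?_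
    unfold TT
    rw [← ENNReal.tsum_mul_left]
    refine tsum_congr fun b => ?_
    rw [add_right_comm]
    ring
  rw [hW]
  have : ∀ F, TT F n = ∑' b : ℕ+, F (n + b) * iv (n + b) := fun F => rfl
  rw [this FS, this iv, this (TT _), this (fun n => iv n * TT iv n), ← ENNReal.tsum_mul_left,
    ← ENNReal.tsum_add, ← ENNReal.tsum_add, ← ENNReal.tsum_add]
  exact tsum_congr fun b => main1 (n + b) (by have := b.pos; omega)

lemma PP_add (r : ℕ) (F G : ℕ → ℝ≥0∞) : PP r (fun n => F n + G n) = PP r F + PP r G := by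
  unfold PP
  rw [← ENNReal.tsum_add]
  exact tsum_congr fun a => add_mul _ _ _

lemma PP_tsum (r : ℕ) (c : ℕ+ → ℝ≥0∞) (F : ℕ+ → ℕ → ℝ≥0∞) :
    PP r (fun n => ∑' m, c m * F m n) = ∑' m, c m * PP r (F m) := by
  unfold PP
  simp_rw [← ENNReal.tsum_mul_left, ← ENNReal.tsum_mul_right]
  rw [ENNReal.tsum_comm]
  simp_rw [mul_assoc]

lemma PP_const_mul (r : ℕ) (c : ℝ≥0∞) (F : ℕ → ℝ≥0∞) :
    PP r (fun n => c * F n) = c * PP r F := by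
  unfold PP
  simp_rw [← ENNReal.tsum_mul_left, mul_assoc]

lemma main3 : PP 4 FS + 24 * DD 5 2 + 120 * DD 6 1 = 24 * (ZZ 2 * ZZ 5) := by
  have h := congrArg (PP 3) (funext main2)
  rw [PP_add, PP_add, PP_add, PP_const_mul, PP_tsum, ← PP_cons] at h
  have h4 := congrArg (fun x : ℝ≥0∞ => ((4 : ℕ) : ℝ≥0∞) * x) h
  simp only [mul_add] at h4
  have hs : ∀ F, ((4 : ℕ) : ℝ≥0∞) * PP 3 (TT F) = PP 4 F := fun F => (PP_succ 3 F).symm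
  rw [mul_left_comm] at h4
  simp only [hs] at h4
  have h3 : PP 4 (TT (fun n => iv n ^ 2)) = 24 * DD 6 1 := by
    rw [PP_iter, ← Function.iterate_succ_apply, V3]
    norm_num [Nat.factorial]
  rw [show 3 + 1 = 4 from rfl, h3, PP_iter 4 iv, V1, PP_iter 4 (fun n => iv n * TT iv n), V2] at h4
  norm_num [Nat.factorial] at h4
  rw [mul_left_comm, ← h4]
  ring

lemma tsum_lt (m : ℕ+) (f : ℕ+ → ℝ≥0∞) :
    ∑' k : ℕ+, f (m + k) = ∑' n : ℕ+, if m < n then f n else 0 := by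
  rw [← Function.Injective.tsum_eq (g := fun k : ℕ+ => m + k) (add_right_injective m)
    (f := fun n => if m < n then f n else 0)]
  · exact tsum_congr fun k => by simp [PNat.lt_add_right]
  · intro n hn
    simp only [Function.mem_support, ne_eq, ite_eq_right_iff, Classical.not_imp] at hn
    exact ⟨n - m, PNat.add_sub_of_lt hn.1⟩

lemma stuffle (s t : ℕ) : ZZ s * ZZ t = DD s t + DD t s + ZZ (s + t) := by
  have h1 : ∀ s t, DD s t = ∑' m : ℕ+, ∑' n : ℕ+, if m < n then iv n ^ s * iv m ^ t else 0 := by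
    intro s t
    unfold DD
    rw [ENNReal.summable.tsum_prod' (fun _ => ENNReal.summable)]
    refine tsum_congr fun m => ?_
    rw [← tsum_lt m (fun n => iv n ^ s * iv m ^ t)]
    simp
  rw [h1 t s, h1 s t, ENNReal.tsum_comm]
  unfold ZZ
  rw [← ENNReal.tsum_add, ← ENNReal.tsum_add, ← ENNReal.tsum_mul_right]
  refine tsum_congr fun m => ?_
  rw [← ENNReal.tsum_mul_left, ← ENNReal.tsum_add, ← tsum_ite_eq m (fun _ => iv m ^ (s + t)),
    ← ENNReal.tsum_add]
  refine tsum_congr fun n => ?_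
  rcases lt_trichotomy m n with h | h | h
  · simp [h, h.not_gt, h.ne', mul_comm]
  · subst h; simp [pow_add]
  · simp [h, h.not_gt, h.ne]

lemma ZZ_mul (s t : ℕ) : ZZ s * ZZ t = ∑' p : ℕ+ × ℕ+, iv p.1 ^ s * iv p.2 ^ t := by
  rw [ENNReal.summable.tsum_prod' (fun _ => ENNReal.summable)]
  unfold ZZ
  rw [← ENNReal.tsum_mul_right]
  exact tsum_congr fun m => ENNReal.tsum_mul_left.symm

lemma DD_swap (s t : ℕ) :
    DD s t = ∑' p : ℕ+ × ℕ+, iv ((p.1 : ℕ) + p.2) ^ s * iv p.2 ^ t := by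
  unfold DD
  rw [← (Equiv.prodComm ℕ+ ℕ+).tsum_eq]
  exact tsum_congr fun p => by simp [add_comm]

lemma pf34 (m n : ℕ) (hm : m ≠ 0) (hn : n ≠ 0) : iv m ^ 3 * iv n ^ 4 =
    10 * (iv (m + n) ^ 6 * iv m ^ 1) + 4 * (iv (m + n) ^ 5 * iv m ^ 2) + iv (m + n) ^ 4 * iv m ^ 3
    + 10 * (iv (m + n) ^ 6 * iv n ^ 1) + 6 * (iv (m + n) ^ 5 * iv n ^ 2)
    + 3 * (iv (m + n) ^ 4 * iv n ^ 3) + iv (m + n) ^ 3 * iv n ^ 4 := by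
  unfold iv
  norm_cast
  have h2 : (m : ℝ≥0) ≠ 0 := by exact_mod_cast hm
  have h3 : (n : ℝ≥0) ≠ 0 := by exact_mod_cast hn
  push_cast
  have h4 : (m + n : ℝ≥0) ≠ 0 := by positivity
  field_simp
  ring

lemma pf25 (m n : ℕ) (hm : m ≠ 0) (hn : n ≠ 0) : iv m ^ 2 * iv n ^ 5 =
    5 * (iv (m + n) ^ 6 * iv m ^ 1) + iv (m + n) ^ 5 * iv m ^ 2
    + 5 * (iv (m + n) ^ 6 * iv n ^ 1) + 4 * (iv (m + n) ^ 5 * iv n ^ 2)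
    + 3 * (iv (m + n) ^ 4 * iv n ^ 3) + 2 * (iv (m + n) ^ 3 * iv n ^ 4)
    + iv (m + n) ^ 2 * iv n ^ 5 := by
  unfold iv
  norm_cast
  have h2 : (m : ℝ≥0) ≠ 0 := by exact_mod_cast hm
  have h3 : (n : ℝ≥0) ≠ 0 := by exact_mod_cast hn
  push_cast
  have h4 : (m + n : ℝ≥0) ≠ 0 := by positivity
  field_simp
  ring

lemma shuffle34 : ZZ 3 * ZZ 4 = 20 * DD 6 1 + 10 * DD 5 2 + 4 * DD 4 3 + DD 3 4 := by
  rw [ZZ_mul, tsum_congr (fun p : ℕ+ × ℕ+ => pf34 p.1 p.2 p.1.pos.ne' p.2.pos.ne')]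
  simp only [ENNReal.tsum_add, ENNReal.tsum_mul_left, ← DD_swap]
  simp only [← DD.eq_1]
  ring

lemma shuffle25 : ZZ 2 * ZZ 5 = 10 * DD 6 1 + 5 * DD 5 2 + 3 * DD 4 3 + 2 * DD 3 4 + DD 2 5 := by
  rw [ZZ_mul, tsum_congr (fun p : ℕ+ × ℕ+ => pf25 p.1 p.2 p.1.pos.ne' p.2.pos.ne')]
  simp only [ENNReal.tsum_add, ENNReal.tsum_mul_left, ← DD_swap]
  simp only [← DD.eq_1]
  ring

lemma iv_ne_top (n : ℕ) : iv n ≠ ⊤ := ENNReal.coe_ne_top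

lemma iv_toReal (n : ℕ) : (iv n).toReal = (n : ℝ)⁻¹ := by simp [iv]

lemma ZZ_ne_top (k : ℕ) (hk : 1 < k) : ZZ k ≠ ⊤ := by
  unfold ZZ iv
  have : (fun n : ℕ+ => ((((n : ℕ) : ℝ≥0)⁻¹ : ℝ≥0) : ℝ≥0∞) ^ k) =
      fun n : ℕ+ => (((((n : ℕ) : ℝ≥0)⁻¹) ^ k : ℝ≥0) : ℝ≥0∞) := by
    funext n; push_cast; rfl
  rw [this, ENNReal.tsum_coe_ne_top_iff_summable]
  have h := (Real.summable_nat_pow_inv.2 hk).comp_injective PNat.coe_injective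
  rw [← NNReal.summable_coe]
  simpa [Function.comp_def] using h

lemma ZZ_zeta (k : ℕ) (hk : 1 < k) : riemannZeta k = ((ZZ k).toReal : ℂ) := by
  rw [zeta_nat_eq_tsum_of_gt_one hk]
  unfold ZZ
  rw [ENNReal.tsum_toReal_eq (fun n : ℕ+ => ENNReal.pow_ne_top (iv_ne_top n)), Complex.ofReal_tsum]
  rw [← Function.Injective.tsum_eq PNat.coe_injective]
  · exact tsum_congr fun n => by simp [iv_toReal]
  · intro n hn
    rcases Nat.eq_zero_or_pos n with h | h
    · subst h
      simp [show k ≠ 0 by omega] at hn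
    · exact ⟨⟨n, h⟩, rfl⟩

lemma zMT_eq : zMTn 5 ![2, 1, 1, 1, 1] 1 = ((PP 4 FS).toReal : ℂ) := by
  have h : PP 4 FS = ∑' m : Fin 5 → ℕ+, iv (m 0) * (∏ j, iv (m j)) * iv (∑ j, (m j : ℕ)) := by
    unfold FS
    rw [PP_tsum, ← (Fin.consEquiv (fun _ : Fin 5 => ℕ+)).tsum_eq,
      ENNReal.summable.tsum_prod' (fun _ => ENNReal.summable)]
    refine tsum_congr fun b => ?_
    unfold PP
    rw [← ENNReal.tsum_mul_left]
    refine tsum_congr fun a => ?_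
    simp only [Fin.consEquiv_apply, Fin.sum_univ_succ (n := 4), Fin.prod_univ_succ (n := 4),
      Fin.cons_zero, Fin.cons_succ]
    ring
  rw [h, ENNReal.tsum_toReal_eq, Complex.ofReal_tsum]
  · unfold zMTn
    refine tsum_congr fun m => ?_
    simp only [ENNReal.toReal_mul, ENNReal.toReal_prod, iv_toReal, Fin.prod_univ_five]
    simp
    ring
  · intro a
    exact ENNReal.mul_ne_top (ENNReal.mul_ne_top (iv_ne_top _)
      (ENNReal.prod_ne_top fun _ _ => iv_ne_top _)) (iv_ne_top _)

theorem stmt_4 :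
    zMTn 5 ![2, 1, 1, 1, 1] 1 =
      (Nat.factorial 4 : ℂ) *
        (riemannZeta 2 * riemannZeta 5 + 3 * riemannZeta 3 * riemannZeta 4
          - 4 * riemannZeta 7) := by
  have z2 := ZZ_zeta 2 (by norm_num)
  have z3 := ZZ_zeta 3 (by norm_num)
  have z4 := ZZ_zeta 4 (by norm_num)
  have z5 := ZZ_zeta 5 (by norm_num)
  have z7 := ZZ_zeta 7 (by norm_num)
  push_cast at z2 z3 z4 z5 z7
  rw [zMT_eq, z2, z3, z4, z5, z7]
  have f2 := ZZ_ne_top 2 (by norm_num)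
  have f3 := ZZ_ne_top 3 (by norm_num)
  have f4 := ZZ_ne_top 4 (by norm_num)
  have f5 := ZZ_ne_top 5 (by norm_num)
  have f7 := ZZ_ne_top 7 (by norm_num)
  have s34 := stuffle 3 4
  have s25 := stuffle 2 5
  have t34 := shuffle34
  have t25 := shuffle25
  have m := main3
  have fP : ZZ 3 * ZZ 4 ≠ ⊤ := ENNReal.mul_ne_top f3 f4
  have fQ : ZZ 2 * ZZ 5 ≠ ⊤ := ENNReal.mul_ne_top f2 f5
  have d34 : DD 3 4 ≠ ⊤ := ne_top_of_le_ne_top fP (by rw [s34, add_assoc]; exact le_self_add)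
  have d43 : DD 4 3 ≠ ⊤ := ne_top_of_le_ne_top fP
    (by rw [s34, add_comm (DD 3 4), add_assoc]; exact le_self_add)
  have d25 : DD 2 5 ≠ ⊤ := ne_top_of_le_ne_top fQ (by rw [s25, add_assoc]; exact le_self_add)
  have d52 : DD 5 2 ≠ ⊤ := ne_top_of_le_ne_top fQ
    (by rw [s25, add_comm (DD 2 5), add_assoc]; exact le_self_add)
  have d61 : DD 6 1 ≠ ⊤ := by
    intro h
    rw [h] at t34
    apply fP
    rw [t34]
    simp
  have fS : PP 4 FS ≠ ⊤ := ne_top_of_le_ne_top (ENNReal.mul_ne_top (by norm_num) fQ : 24 * (ZZ 2 * ZZ 5) ≠ ⊤)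
    (by rw [← m, add_assoc]; exact le_self_add)
  lift ZZ 2 to ℝ≥0 using f2 with x2
  lift ZZ 3 to ℝ≥0 using f3 with x3
  lift ZZ 4 to ℝ≥0 using f4 with x4
  lift ZZ 5 to ℝ≥0 using f5 with x5
  norm_num only at s34 s25
  lift ZZ 7 to ℝ≥0 using f7 with x7
  lift DD 3 4 to ℝ≥0 using d34 with y34
  lift DD 4 3 to ℝ≥0 using d43 with y43
  lift DD 2 5 to ℝ≥0 using d25 with y25
  lift DD 5 2 to ℝ≥0 using d52 with y52
  lift DD 6 1 to ℝ≥0 using d61 with y61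
  lift PP 4 FS to ℝ≥0 using fS with w
  norm_cast at s34 s25 t34 t25 m
  have s34' := congrArg NNReal.toReal s34
  have s25' := congrArg NNReal.toReal s25
  have t34' := congrArg NNReal.toReal t34
  have t25' := congrArg NNReal.toReal t25
  have m' := congrArg NNReal.toReal m
  push_cast at s34' s25' t34' t25' m'
  have : (w : ℝ) = 24 * (x2 * x5 + 3 * x3 * x4 - 4 * x7) := by
    linarith
  simp only [ENNReal.coe_toReal, this, Nat.factorial]
  push_cast
  ring
end

section
/- For every k ∈ ℕ with k ≥ 1, ζ_{MT,2k+1}(2,1,...,1;1) (2k ones) equals (2k)!·{ ζ(2)ζ(2k+1) − (1/2)(2k²+k−2)ζ(2k+3) + ∑_{n=1}^{k−1} (2k+1−2n)ζ(2n+1)ζ(2k+2−2n) }. -/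
open scoped BigOperators

open Finset Filter Topology

noncomputable def Zr (s : ℕ) : ℝ := ∑' n : ℕ, 1 / ((n : ℝ) + 1) ^ s
noncomputable def Hr (s j : ℕ) : ℝ := ∑ i ∈ range j, 1 / ((i : ℝ) + 1) ^ s

lemma hs_congr {α : Type*} {f g : α → ℝ} {a b : ℝ} (h : HasSum f a) (hf : ∀ i, g i = f i)
    (hb : b = a) : HasSum g b := by
  have : g = f := funext hf
  rw [this, hb]; exact h

lemma Zr_summable {s : ℕ} (hs : 2 ≤ s) : Summable fun n : ℕ => 1 / ((n : ℝ) + 1) ^ s := by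
  have h := (summable_nat_add_iff 1).2 (Real.summable_one_div_nat_pow.2 (show 1 < s by omega))
  simpa using h

lemma Hr_succ (s j : ℕ) : Hr s (j + 1) = Hr s j + 1 / ((j : ℝ) + 1) ^ s := by
  simp [Hr, sum_range_succ]

lemma tele1 (d : ℕ) : HasSum (fun i : ℕ => 1 / ((i : ℝ) + 1 + d) - 1 / ((i : ℝ) + 1 + (d + 1)))
    (1 / ((d : ℝ) + 1)) := by
  rw [hasSum_iff_tendsto_nat_of_nonneg]
  · have h : ∀ n : ℕ, ∑ i ∈ range n, (1 / ((i : ℝ) + 1 + d) - 1 / ((i : ℝ) + 1 + (d + 1)))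
        = 1 / ((d : ℝ) + 1) - 1 / ((n : ℝ) + ((d : ℝ) + 1)) := by
      intro n
      have := Finset.sum_range_sub' (fun i : ℕ => 1 / ((i : ℝ) + 1 + d)) n
      rw [show 1 / ((d : ℝ) + 1) - 1 / ((n : ℝ) + ((d : ℝ) + 1))
        = 1 / (((0 : ℕ) : ℝ) + 1 + d) - 1 / ((n : ℝ) + 1 + d) by push_cast; ring_nf, ← this]
      refine sum_congr rfl fun i _ => ?_
      push_cast; ring_nf
    simp_rw [h]
    have h2 : Tendsto (fun n : ℕ => 1 / ((n : ℝ) + ((d : ℝ) + 1))) atTop (𝓝 0) := by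
      have := (tendsto_const_nhds (x := (1 : ℝ))).div_atTop
        (tendsto_atTop_add_const_right atTop ((d : ℝ) + 1) (tendsto_natCast_atTop_atTop (R := ℝ)))
      simpa using this
    simpa using (tendsto_const_nhds (x := 1 / ((d : ℝ) + 1))).sub h2
  · intro i
    rw [sub_nonneg]
    apply one_div_le_one_div_of_le <;> [positivity; linarith]

lemma tele (d : ℕ) : HasSum (fun i : ℕ => 1 / ((i : ℝ) + 1) - 1 / ((i : ℝ) + 1 + d)) (Hr 1 d) := by
  induction d with
  | zero => simp [Hr]
  | succ d ih =>
    rw [Hr_succ]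
    have := ih.add (tele1 d)
    refine hs_congr this (fun i => ?_) ?_
    · push_cast; ring
    · simp

lemma tail2 (d : ℕ) : HasSum (fun i : ℕ => 1 / ((i : ℝ) + 1 + d) ^ 2) (Zr 2 - Hr 2 d) := by
  have h := (hasSum_nat_add_iff' d).2 (Zr_summable le_rfl).hasSum
  refine hs_congr h (fun i => ?_) rfl
  push_cast; ring

lemma refl_sum (s j : ℕ) : ∑ i ∈ range j, 1 / ((j : ℝ) - i) ^ s = Hr s j := by
  rw [Hr, ← Finset.sum_range_reflect]
  refine sum_congr rfl fun i hi => ?_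
  have := mem_range.1 hi
  congr 2
  rw [Nat.sub_sub, Nat.cast_sub (by omega)]; push_cast; ring

lemma offVm (j : ℕ) : HasSum (fun i : ℕ => if i = j then (0 : ℝ) else
    1 / (((i : ℝ) + 1) - ((j : ℝ) + 1)) ^ 2) (Zr 2 + Hr 2 j) := by
  have h : HasSum (fun n : ℕ => 1 / (((n : ℝ) + 1) ^ 2)) (Zr 2) := (Zr_summable le_rfl).hasSum
  have e : Zr 2 + Hr 2 j = Zr 2 + ∑ i ∈ range (j + 1), (if i = j then (0 : ℝ) else
    1 / (((i : ℝ) + 1) - ((j : ℝ) + 1)) ^ 2) := by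
    rw [sum_range_succ, ← refl_sum]
    simp only [if_true, add_zero]
    congr 1
    refine sum_congr rfl fun i hi => ?_
    rw [if_neg (by have := mem_range.1 hi; omega)]
    congr 1; ring
  rw [e]
  apply (hasSum_nat_add_iff (j + 1)).1
  refine hs_congr h (fun i => ?_) rfl
  rw [if_neg (by omega)]
  push_cast; congr 1; ring

lemma hasSum_off {f : ℕ → ℝ} {a : ℝ} (h : HasSum f a) (j : ℕ) :
    HasSum (fun i => if i = j then (0 : ℝ) else f i) (a - f j) := by
  have := h.sub (hasSum_ite_eq j (f j))
  refine hs_congr this (fun i => ?_) rfl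
  split_ifs with hi <;> simp [hi]

lemma offVp (j : ℕ) : HasSum (fun i : ℕ => if i = j then (0 : ℝ) else
    1 / (((i : ℝ) + 1) + ((j : ℝ) + 1)) ^ 2) (Zr 2 - Hr 2 j - 5 / (4 * ((j : ℝ) + 1) ^ 2)) := by
  have h := hasSum_off (tail2 (j + 1)) j
  refine hs_congr h (fun i => ?_) ?_
  · push_cast; rfl
  · rw [Hr_succ]; push_cast
    have : (j : ℝ) + 1 ≠ 0 := by positivity
    field_simp; ring

lemma offU (j : ℕ) : HasSum (fun i : ℕ => if i = j then (0 : ℝ) else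
    (1 / (((i : ℝ) + 1) - ((j : ℝ) + 1)) + 1 / (((i : ℝ) + 1) + ((j : ℝ) + 1))) / 2
      - 1 / ((i : ℝ) + 1)) (-Hr 1 j + 1 / (4 * ((j : ℝ) + 1))) := by
  have h1 := hasSum_off (tele (j + 1)) j
  have h2 : HasSum (fun i : ℕ => if i = j then (0 : ℝ) else
      1 / (((i : ℝ) + 1) - ((j : ℝ) + 1)) - 1 / ((i : ℝ) + 1)) (Hr 1 (j + 1) - 2 * Hr 1 j) := by
    have e : Hr 1 (j + 1) - 2 * Hr 1 j = Hr 1 (j + 1) + ∑ i ∈ range (j + 1),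
        (if i = j then (0 : ℝ) else
          1 / (((i : ℝ) + 1) - ((j : ℝ) + 1)) - 1 / ((i : ℝ) + 1)) := by
      rw [sum_range_succ]
      simp only [if_true, add_zero]
      have : ∑ i ∈ range j, (if i = j then (0 : ℝ) else
          1 / (((i : ℝ) + 1) - ((j : ℝ) + 1)) - 1 / ((i : ℝ) + 1)) =
          ∑ i ∈ range j, (-(1 / ((j : ℝ) - i) ^ 1) - 1 / ((i : ℝ) + 1) ^ 1) := by
        refine sum_congr rfl fun i hi => ?_
        rw [if_neg (by have := mem_range.1 hi; omega), pow_one, pow_one, ← one_div_neg_eq_neg_one_div]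
        congr 2; ring
      rw [this, sum_sub_distrib, sum_neg_distrib, refl_sum, ← Hr]
      ring
    rw [e]
    apply (hasSum_nat_add_iff (j + 1)).1
    refine hs_congr (tele (j + 1)) (fun i => ?_) rfl
    rw [if_neg (by omega)]
    push_cast; congr 2 <;> ring
  have h := (h2.sub h1).div_const 2
  refine hs_congr h (fun i => ?_) ?_
  · split_ifs
    · simp
    · push_cast; ring
  · rw [Hr_succ]; push_cast
    have : (j : ℝ) + 1 ≠ 0 := by positivity
    field_simp; ring

lemma pf_id (k : ℕ) (p q : ℝ) (hp : 0 < p) (hq : 0 < q) (hpq : p ≠ q) :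
    ∑ n ∈ range k, (2 * (k : ℝ) - 1 - 2 * n) * (1 / p ^ (2 * n + 3) * (1 / q ^ (2 * k - 2 * n))) =
      (2 * (k : ℝ) + 1) / q ^ (2 * k + 2) * ((1 / (p - q) + 1 / (p + q)) / 2 - 1 / p)
      - (1 / (p - q) ^ 2 - 1 / (p + q) ^ 2) / (2 * q ^ (2 * k + 1))
      + (1 / (p - q) ^ 2 + 1 / (p + q) ^ 2) / (2 * p ^ (2 * k + 1)) := by
  have h1 : p - q ≠ 0 := sub_ne_zero.2 hpq
  have h2 : p + q ≠ 0 := by positivity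
  have hp' := hp.ne'
  have hq' := hq.ne'
  induction k with
  | zero =>
    simp only [range_zero, sum_empty, Nat.cast_zero]
    field_simp
    ring
  | succ k ih =>
    rw [sum_range_succ']
    have e : ∑ n ∈ range k, (2 * ((k + 1 : ℕ) : ℝ) - 1 - 2 * ((n + 1 : ℕ) : ℝ)) *
        (1 / p ^ (2 * (n + 1) + 3) * (1 / q ^ (2 * (k + 1) - 2 * (n + 1)))) =
        1 / p ^ 2 * ∑ n ∈ range k, (2 * (k : ℝ) - 1 - 2 * n) *
          (1 / p ^ (2 * n + 3) * (1 / q ^ (2 * k - 2 * n))) := by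
      rw [mul_sum]
      refine sum_congr rfl fun n _ => ?_
      rw [show 2 * (k + 1) - 2 * (n + 1) = 2 * k - 2 * n by omega,
        show 2 * (n + 1) + 3 = 2 + (2 * n + 3) by ring, pow_add]
      push_cast
      field_simp
      ring
    rw [e, ih]
    simp only [Nat.mul_zero, Nat.sub_zero, Nat.cast_zero, Nat.zero_add]
    rw [show 2 * (k + 1) + 2 = 2 * k + 4 by ring, show 2 * (k + 1) + 1 = 2 * k + 3 by ring,
      show 2 * (k + 1) = 2 * k + 2 by ring]
    simp only [pow_add]
    have hQ : q ^ (2 * k) ≠ 0 := by positivity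
    have hP : p ^ (2 * k) ≠ 0 := by positivity
    generalize q ^ (2 * k) = Q at *
    generalize p ^ (2 * k) = P at *
    push_cast
    field_simp
    ring

lemma Hr_nonneg (s j : ℕ) : 0 ≤ Hr s j := sum_nonneg fun i _ => by positivity

lemma Hr_le (s j : ℕ) : Hr s j ≤ j := by
  have : Hr s j ≤ ∑ i ∈ range j, (1 : ℝ) := by
    refine sum_le_sum fun i _ => ?_
    rw [div_le_one (by positivity)]
    exact one_le_pow₀ (by linarith [Nat.cast_nonneg (α := ℝ) i])
  simpa using this

lemma Hr_summable {s t : ℕ} (ht : 3 ≤ t) : Summable fun j : ℕ => Hr s j / ((j : ℝ) + 1) ^ t := by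
  obtain ⟨u, rfl⟩ : ∃ u, t = u + 1 := ⟨t - 1, by omega⟩
  refine Summable.of_nonneg_of_le (fun j => div_nonneg (Hr_nonneg _ _) (by positivity)) (fun j => ?_)
    (Zr_summable (show 2 ≤ u by omega))
  rw [div_le_div_iff₀ (by positivity) (by positivity), pow_succ]
  have := Hr_le s j
  have h : (0 : ℝ) < ((j : ℝ) + 1) ^ u := by positivity
  nlinarith

lemma sum_coef (k : ℕ) : ∑ n ∈ range k, (2 * (k : ℝ) - 1 - 2 * n) = (k : ℝ) ^ 2 := by
  induction k with
  | zero => simp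
  | succ k ih =>
    rw [sum_range_succ']
    rw [show ((k + 1 : ℕ) : ℝ) ^ 2 = (k : ℝ) ^ 2 + (2 * k + 1) by push_cast; ring, ← ih]
    congr 1
    · refine sum_congr rfl fun n _ => ?_
      push_cast; ring
    · push_cast; ring

lemma ZZ_s5 {a b : ℕ} (ha : 2 ≤ a) (hb : 2 ≤ b) : HasSum (fun x : ℕ × ℕ =>
    1 / ((x.1 : ℝ) + 1) ^ a * (1 / ((x.2 : ℝ) + 1) ^ b)) (Zr a * Zr b) := by
  have h := Summable.mul_of_nonneg (Zr_summable ha) (Zr_summable hb)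
    (fun n => by simp only [Pi.zero_apply]; positivity)
    (fun n => by simp only [Pi.zero_apply]; positivity)
  have e := (Zr_summable ha).tsum_mul_tsum (Zr_summable hb) h
  rw [Zr, Zr, e]
  exact h.hasSum

theorem partB (k : ℕ) (hk : 1 ≤ k) :
    ∑ n ∈ range k, (2 * (k : ℝ) - 1 - 2 * n) * (Zr (2 * n + 3) * Zr (2 * k - 2 * n)) =
      (k : ℝ) ^ 2 * Zr (2 * k + 3) + (Zr 2 * Zr (2 * k + 1) - 5 / 8 * Zr (2 * k + 3))
      + (-(2 * (k : ℝ) + 1) * (∑' j : ℕ, Hr 1 j / ((j : ℝ) + 1) ^ (2 * k + 2))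
        + (2 * (k : ℝ) + 1) / 4 * Zr (2 * k + 3)
        - (∑' j : ℕ, Hr 2 j / ((j : ℝ) + 1) ^ (2 * k + 1)) - 5 / 8 * Zr (2 * k + 3)) := by
  set F : ℕ × ℕ → ℝ := fun x => ∑ n ∈ range k, (2 * (k : ℝ) - 1 - 2 * n) *
    (1 / ((x.1 : ℝ) + 1) ^ (2 * n + 3) * (1 / ((x.2 : ℝ) + 1) ^ (2 * k - 2 * n))) with hF
  have hFs : HasSum F
      (∑ n ∈ range k, (2 * (k : ℝ) - 1 - 2 * n) * (Zr (2 * n + 3) * Zr (2 * k - 2 * n))) := by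
    refine hasSum_sum fun n hn => HasSum.mul_left _ ?_
    have hn' := mem_range.1 hn
    exact ZZ_s5 (by omega) (by omega)
  -- diagonal
  set D : ℕ × ℕ → ℝ := fun x => if x.1 = x.2 then (k : ℝ) ^ 2 * (1 / ((x.1 : ℝ) + 1) ^ (2 * k + 3))
    else 0 with hD
  have hDs : HasSum D ((k : ℝ) ^ 2 * Zr (2 * k + 3)) := by
    have hinj : Function.Injective (fun i : ℕ => (i, i)) := fun a b h => (Prod.mk.inj h).1
    refine (hinj.hasSum_iff ?_).1 ?_
    · rintro ⟨a, b⟩ hx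
      simp only [hD]
      rw [if_neg]
      rintro rfl
      exact hx ⟨a, rfl⟩
    · refine hs_congr ((Zr_summable (show 2 ≤ 2 * k + 3 by omega)).hasSum.mul_left ((k : ℝ) ^ 2))
        (fun i => ?_) rfl
      simp [hD]
  set B : ℕ × ℕ → ℝ := fun x => if x.1 = x.2 then 0 else
    (1 / (((x.1 : ℝ) + 1) - ((x.2 : ℝ) + 1)) ^ 2 + 1 / (((x.1 : ℝ) + 1) + ((x.2 : ℝ) + 1)) ^ 2) /
      (2 * ((x.1 : ℝ) + 1) ^ (2 * k + 1)) with hB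
  have hBin : ∀ i : ℕ, HasSum (fun j => B (i, j))
      (Zr 2 * (1 / ((i : ℝ) + 1) ^ (2 * k + 1)) - 5 / 8 * (1 / ((i : ℝ) + 1) ^ (2 * k + 3))) := by
    intro i
    have h := ((offVm i).add (offVp i)).div_const (2 * ((i : ℝ) + 1) ^ (2 * k + 1))
    refine hs_congr h (fun j => ?_) ?_
    · simp only [hB, eq_comm (a := i)]
      split_ifs
      · simp
      · congr 3
        · ring
        · ring
    · have : (i : ℝ) + 1 ≠ 0 := by positivity
      rw [show 2 * k + 3 = 2 * k + 1 + 2 by ring, pow_add]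
      field_simp
      ring
  have hBout : HasSum (fun i : ℕ => Zr 2 * (1 / ((i : ℝ) + 1) ^ (2 * k + 1))
      - 5 / 8 * (1 / ((i : ℝ) + 1) ^ (2 * k + 3)))
      (Zr 2 * Zr (2 * k + 1) - 5 / 8 * Zr (2 * k + 3)) :=
    ((Zr_summable (show 2 ≤ 2 * k + 1 by omega)).hasSum.mul_left _).sub
      ((Zr_summable (show 2 ≤ 2 * k + 3 by omega)).hasSum.mul_left _)
  have hBsum : Summable B := by
    rw [summable_prod_of_nonneg]
    · refine ⟨fun i => (hBin i).summable, ?_⟩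
      simp_rw [fun i => (hBin i).tsum_eq]
      exact hBout.summable
    · rintro ⟨i, j⟩
      simp only [hB, Pi.zero_apply]
      split_ifs
      · exact le_rfl
      · positivity
  have hBs : HasSum B (Zr 2 * Zr (2 * k + 1) - 5 / 8 * Zr (2 * k + 3)) := by
    have := hBsum.hasSum.prod_fiberwise hBin
    rw [← this.unique hBout]
    exact hBsum.hasSum
  set A : ℕ × ℕ → ℝ := fun x => if x.1 = x.2 then 0 else
    (2 * (k : ℝ) + 1) / ((x.2 : ℝ) + 1) ^ (2 * k + 2) *
      ((1 / (((x.1 : ℝ) + 1) - ((x.2 : ℝ) + 1)) + 1 / (((x.1 : ℝ) + 1) + ((x.2 : ℝ) + 1))) / 2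
        - 1 / ((x.1 : ℝ) + 1))
      - (1 / (((x.1 : ℝ) + 1) - ((x.2 : ℝ) + 1)) ^ 2 - 1 / (((x.1 : ℝ) + 1) + ((x.2 : ℝ) + 1)) ^ 2)
        / (2 * ((x.2 : ℝ) + 1) ^ (2 * k + 1)) with hA
  have hFA : ∀ x, F x = D x + B x + A x := by
    rintro ⟨i, j⟩
    simp only [hF, hD, hB, hA]
    split_ifs with hij
    · subst hij
      rw [add_zero, add_zero, ← sum_coef, sum_mul]
      refine sum_congr rfl fun n hn => ?_
      have hn' := mem_range.1 hn
      rw [one_div_mul_one_div, ← pow_add, show 2 * n + 3 + (2 * k - 2 * n) = 2 * k + 3 by omega]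
    · rw [pf_id k _ _ (by positivity) (by positivity)
        (by simpa using hij)]
      ring
  have hAs := (hFs.sub hDs).sub hBs
  replace hAs := hs_congr hAs (g := A) (fun x => by rw [hFA]; ring) rfl
  have hAin : ∀ j : ℕ, HasSum (fun i => A (i, j))
      (-(2 * (k : ℝ) + 1) * (Hr 1 j / ((j : ℝ) + 1) ^ (2 * k + 2))
        + (2 * (k : ℝ) + 1) / 4 * (1 / ((j : ℝ) + 1) ^ (2 * k + 3))
        - Hr 2 j / ((j : ℝ) + 1) ^ (2 * k + 1) - 5 / 8 * (1 / ((j : ℝ) + 1) ^ (2 * k + 3))) := by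
    intro j
    have h := ((offU j).mul_left ((2 * (k : ℝ) + 1) / ((j : ℝ) + 1) ^ (2 * k + 2))).sub
      (((offVm j).sub (offVp j)).div_const (2 * ((j : ℝ) + 1) ^ (2 * k + 1)))
    refine hs_congr h (fun i => ?_) ?_
    · simp only [hA]
      split_ifs
      · simp
      · rfl
    · have : (j : ℝ) + 1 ≠ 0 := by positivity
      rw [show 2 * k + 3 = 2 * k + 1 + 2 by ring, show 2 * k + 2 = 2 * k + 1 + 1 by ring, pow_add,
        pow_add _ _ 1]
      field_simp
      ring
  have hAout := ((((Hr_summable (s := 1) (show 3 ≤ 2 * k + 2 by omega)).hasSum.mul_left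
      (-(2 * (k : ℝ) + 1))).add
      ((Zr_summable (show 2 ≤ 2 * k + 3 by omega)).hasSum.mul_left ((2 * (k : ℝ) + 1) / 4))).sub
      (Hr_summable (s := 2) (show 3 ≤ 2 * k + 1 by omega)).hasSum).sub
      ((Zr_summable (show 2 ≤ 2 * k + 3 by omega)).hasSum.mul_left (5 / 8))
  have hA2 := ((Equiv.prodComm ℕ ℕ).hasSum_iff.2 hAs).prod_fiberwise hAin
  have := hA2.unique hAout
  have hZ : ∑' n : ℕ, 1 / ((n : ℝ) + 1) ^ (2 * k + 3) = Zr (2 * k + 3) := rfl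
  rw [hZ] at this
  linarith

open MeasureTheory in
lemma logI (n e : ℕ) : ∫⁻ y in Set.Ioo (0 : ℝ) 1, ENNReal.ofReal (y ^ n * (-Real.log y) ^ e) =
    ENNReal.ofReal ((e.factorial : ℝ) / ((n : ℝ) + 1) ^ (e + 1)) := by
  have himg : (fun t : ℝ => Real.exp (-t)) '' Set.Ioi 0 = Set.Ioo 0 1 := by
    ext y
    constructor
    · rintro ⟨t, ht, rfl⟩
      refine ⟨Real.exp_pos _, ?_⟩
      have : (0 : ℝ) < t := ht
      simpa using this
    · rintro ⟨h0, h1⟩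
      refine ⟨-Real.log y, ?_, by simp [Real.exp_log h0]⟩
      have := Real.log_neg h0 h1
      simpa using this
  rw [← himg, lintegral_image_eq_lintegral_abs_deriv_mul (f' := fun t => -Real.exp (-t))
    measurableSet_Ioi]
  · have hG := ProbabilityTheory.lintegral_gammaPDF_eq_one (a := (e : ℝ) + 1) (r := (n : ℝ) + 1)
      (by positivity) (by positivity)
    have hsplit : ∫⁻ x in Set.Ioi (0 : ℝ), ProbabilityTheory.gammaPDF ((e : ℝ) + 1) ((n : ℝ) + 1) x
        = 1 := by
      have h := lintegral_add_compl
        (ProbabilityTheory.gammaPDF ((e : ℝ) + 1) ((n : ℝ) + 1)) (μ := volume)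
        (measurableSet_Ici (a := (0 : ℝ)))
      rw [hG, Set.compl_Ici, ProbabilityTheory.lintegral_gammaPDF_of_nonpos le_rfl, add_zero] at h
      rw [← h]
      exact setLIntegral_congr Ioi_ae_eq_Ici
    set c : ℝ := (e.factorial : ℝ) / ((n : ℝ) + 1) ^ (e + 1) with hc
    have hc0 : 0 ≤ c := by positivity
    rw [← mul_one (ENNReal.ofReal c), ← hsplit, ← lintegral_const_mul']
    · refine setLIntegral_congr_fun measurableSet_Ioi fun t ht => ?_
      have ht' : (0 : ℝ) < t := ht
      rw [ProbabilityTheory.gammaPDF_of_nonneg ht'.le, ← ENNReal.ofReal_mul (abs_nonneg _),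
        ← ENNReal.ofReal_mul hc0]
      congr 1
      rw [abs_neg, abs_of_pos (Real.exp_pos _), Real.log_exp, neg_neg, Real.Gamma_nat_eq_factorial,
        add_sub_cancel_right, Real.rpow_natCast, hc,
        show (e : ℝ) + 1 = ((e + 1 : ℕ) : ℝ) by push_cast; rfl, Real.rpow_natCast,
        ← Real.exp_nat_mul]
      have h1 : (e.factorial : ℝ) ≠ 0 := by positivity
      have h2 : ((n : ℝ) + 1) ^ (e + 1) ≠ 0 := by positivity
      rw [show -((((n : ℝ) + 1)) * t) = -t + n * -t by ring, Real.exp_add]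
      field_simp
    · exact ENNReal.ofReal_ne_top
  · intro t _
    have := ((hasDerivAt_id t).neg.exp).hasDerivWithinAt (s := Set.Ioi 0)
    simpa using this
  · intro a _ b _ h
    simpa using h

lemma tsum_pi_prod : ∀ (r : ℕ) (g : Fin r → ℕ+ → ENNReal),
    ∑' m : Fin r → ℕ+, ∏ j, g j (m j) = ∏ j, ∑' n, g j n := by
  intro r
  induction r with
  | zero => intro g; simp [tsum_fintype]
  | succ r ih =>
    intro g
    rw [← (Fin.consEquiv (fun _ : Fin (r + 1) => ℕ+)).tsum_eq, ENNReal.tsum_prod', 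
      Fin.prod_univ_succ, ← ih]
    simp only [Fin.consEquiv, Equiv.coe_fn_mk, Fin.prod_univ_succ, Fin.cons_zero, Fin.cons_succ]
    simp_rw [ENNReal.tsum_mul_left, ENNReal.tsum_mul_right]

noncomputable def Lis (s : ℕ) (x : ℝ) : ℝ := ∑' n : ℕ, x ^ (n + 1) / ((n : ℝ) + 1) ^ s

lemma Lis_summable (s : ℕ) {x : ℝ} (h0 : 0 ≤ x) (h1 : x < 1) :
    Summable fun n : ℕ => x ^ (n + 1) / ((n : ℝ) + 1) ^ s := by
  refine Summable.of_nonneg_of_le (fun n => by positivity) (fun n => ?_)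
    ((summable_nat_add_iff 1).2 (summable_geometric_of_lt_one h0 h1))
  apply div_le_self (by positivity)
  exact one_le_pow₀ (by linarith [Nat.cast_nonneg (α := ℝ) n])

lemma Lis_one {x : ℝ} (h0 : 0 ≤ x) (h1 : x < 1) : Lis 1 x = -Real.log (1 - x) := by
  have := (Real.hasSum_pow_div_log_of_abs_lt_one (x := x) (by rw [abs_of_nonneg h0]; exact h1)).tsum_eq
  simpa [Lis] using this

lemma Lis_nonneg (s : ℕ) {x : ℝ} (h0 : 0 ≤ x) : 0 ≤ Lis s x :=
  tsum_nonneg fun n => by positivity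

lemma Lis_cont : ContinuousOn (Lis 2) (Set.Icc 0 1) := by
  unfold Lis
  refine continuousOn_tsum (u := fun n : ℕ => 1 / ((n : ℝ) + 1) ^ 2) (fun n => by fun_prop)
    (Zr_summable le_rfl) ?_
  rintro n x ⟨h0, h1⟩
  rw [Real.norm_of_nonneg (by positivity)]
  gcongr
  exact pow_le_one₀ h0 h1

lemma Lis_deriv {x : ℝ} (h0 : 0 < x) (h1 : x < 1) :
    HasDerivAt (Lis 2) (-Real.log (1 - x) / x) x := by
  have hr0 : 0 < (1 + x) / 2 := by linarith
  have hr1 : (1 + x) / 2 < 1 := by linarith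
  have hx : x ∈ Set.Ioo 0 ((1 + x) / 2) := ⟨h0, by linarith⟩
  have h := hasDerivAt_tsum_of_isPreconnected (𝕜 := ℝ) (F := ℝ)
    (g := fun (n : ℕ) (y : ℝ) => y ^ (n + 1) / ((n : ℝ) + 1) ^ 2)
    (g' := fun (n : ℕ) (y : ℝ) => y ^ n / ((n : ℝ) + 1))
    (summable_geometric_of_lt_one hr0.le hr1) (isOpen_Ioo (a := (0 : ℝ)) (b := (1 + x) / 2))
    isPreconnected_Ioo ?_ ?_ hx (Lis_summable 2 h0.le h1) hx
  · convert! h using 1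
    rw [← Lis_one h0.le h1, Lis, ← tsum_div_const]
    refine tsum_congr fun n => ?_
    rw [pow_succ]; field_simp
  · intro n y _
    have := (hasDerivAt_pow (n + 1) y).div_const (((n : ℝ) + 1) ^ 2)
    convert! this using 1
    push_cast
    have : (n : ℝ) + 1 ≠ 0 := by positivity
    field_simp
  · rintro n y ⟨hy0, hy1⟩
    rw [Real.norm_of_nonneg (by positivity)]
    calc y ^ n / ((n : ℝ) + 1) ≤ y ^ n :=
          div_le_self (by positivity) (by linarith [Nat.cast_nonneg (α := ℝ) n])
      _ ≤ _ := by gcongr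

lemma Lis_refl {y : ℝ} (h0 : 0 < y) (h1 : y < 1) :
    Lis 2 (1 - y) + Real.log y * Real.log (1 - y) + Lis 2 y = Zr 2 := by
  set f : ℝ → ℝ := fun y => Lis 2 (1 - y) + Real.log y * Real.log (1 - y) + Lis 2 y with hf
  have hd : ∀ z ∈ Set.Ioo (0 : ℝ) 1, HasDerivAt f 0 z := by
    rintro z ⟨hz0, hz1⟩
    have hs : HasDerivAt (fun w : ℝ => 1 - w) (-1) z := by
      simpa using (hasDerivAt_id z).const_sub 1
    have d1 : HasDerivAt (fun w => Lis 2 (1 - w)) (-Real.log (1 - (1 - z)) / (1 - z) * (-1)) z :=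
      (Lis_deriv (x := 1 - z) (by linarith) (by linarith)).comp z hs
    have d2 := (Real.hasDerivAt_log hz0.ne').mul (hs.log (sub_ne_zero.2 hz1.ne'))
    have := (d1.add d2).add (Lis_deriv hz0 hz1)
    convert! this using 1
    rw [sub_sub_cancel]
    have : 1 - z ≠ 0 := sub_ne_zero.2 hz1.ne'
    have := hz0.ne'
    field_simp
    ring
  have hconst : ∀ z ∈ Set.Ioo (0 : ℝ) 1, f z = f y := by
    intro z hz
    exact IsOpen.is_const_of_deriv_eq_zero isOpen_Ioo isPreconnected_Ioo
      (fun w hw => (hd w hw).differentiableAt.differentiableWithinAt)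
      (fun w hw => (hd w hw).deriv) hz ⟨h0, h1⟩
  have hlim : Tendsto f (𝓝[>] 0) (𝓝 (Zr 2 + 0 + 0)) := by
    have hev : ∀ᶠ z in 𝓝[>] (0 : ℝ), z ∈ Set.Ioo (0 : ℝ) 1 :=
      Ioo_mem_nhdsGT one_pos
    have l0 : Lis 2 0 = 0 := by simp [Lis]
    have l1 : Lis 2 1 = Zr 2 := by simp [Lis, Zr]
    refine (Tendsto.add ?_ ?_).add ?_
    · rw [← l1]
      refine (Lis_cont 1 (by simp)).tendsto.comp ?_
      refine tendsto_nhdsWithin_iff.2 ⟨?_, ?_⟩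
      · have : Tendsto (fun n : ℝ => 1 - n) (𝓝 0) (𝓝 (1 - 0)) :=
          (continuous_const.sub continuous_id).tendsto 0
        rw [sub_zero] at this
        exact this.mono_left nhdsWithin_le_nhds
      · filter_upwards [hev] with z hz
        exact ⟨by linarith [hz.2], by linarith [hz.1]⟩
    · have a1 : Tendsto (fun z : ℝ => z * Real.log z) (𝓝[>] 0) (𝓝 0) := by
        have := Real.continuous_mul_log.tendsto 0
        simp only [zero_mul] at this
        exact this.mono_left nhdsWithin_le_nhds
      have a2 : Tendsto (fun z : ℝ => z⁻¹ * Real.log (1 - z)) (𝓝[>] 0) (𝓝 (-1)) := by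
        have hs : HasDerivAt (fun w : ℝ => 1 - w) (-1) 0 := by
          simpa using (hasDerivAt_id (0 : ℝ)).const_sub 1
        have hl := hs.log (by norm_num)
        have := hl.tendsto_slope_zero_right
        simpa using this
      have := a1.mul a2
      rw [zero_mul] at this
      refine this.congr' ?_
      filter_upwards [hev] with z hz
      have := hz.1.ne'
      field_simp
    · have hc := (Lis_cont 0 (by simp)).tendsto
      rw [l0] at hc
      refine hc.mono_left ?_
      rw [nhdsWithin_le_iff]
      filter_upwards [hev] with z hz
      exact ⟨hz.1.le, hz.2.le⟩
  have hlim2 : Tendsto f (𝓝[>] 0) (𝓝 (f y)) := by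
    refine tendsto_const_nhds.congr' ?_
    filter_upwards [Ioo_mem_nhdsGT (one_pos (α := ℝ))] with z hz
    exact (hconst z hz).symm
  have := tendsto_nhds_unique hlim2 hlim
  simpa [hf] using this

lemma Lis_geom (s : ℕ) {y : ℝ} (h0 : 0 < y) (h1 : y < 1) :
    HasSum (fun n : ℕ => Hr s (n + 1) * y ^ (n + 1)) (Lis s y / (1 - y)) := by
  have hg := summable_geometric_of_lt_one h0.le h1
  have e : ∀ n : ℕ, Hr s (n + 1) * y ^ (n + 1) =
      ∑ k ∈ range (n + 1), y ^ (k + 1) / ((k : ℝ) + 1) ^ s * y ^ (n - k) := by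
    intro n
    rw [Hr, sum_mul]
    refine sum_congr rfl fun k hk => ?_
    have := mem_range.1 hk
    rw [show n + 1 = (k + 1) + (n - k) by omega, pow_add]
    ring
  have hn1 := (Lis_summable s h0.le h1).norm
  have hn2 := hg.norm
  have ht := tsum_mul_tsum_eq_tsum_sum_range_of_summable_norm hn1 hn2
  have hsum := (summable_norm_sum_mul_range_of_summable_norm hn1 hn2).of_norm
  rw [tsum_geometric_of_lt_one h0.le h1, ← Lis, ← div_eq_mul_inv] at ht
  rw [ht]
  simp_rw [e]
  exact hsum.hasSum

section
open MeasureTheory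

noncomputable def aF (k : ℕ) : Fin (2 * k + 1) → ℕ := fun i => if (i : ℕ) = 0 then 2 else 1

noncomputable def fV (k : ℕ) (x : ℝ) : ENNReal :=
  ∑' m : Fin (2 * k + 1) → ℕ+,
    ENNReal.ofReal ((∏ j, (x ^ (m j : ℕ) / ((m j : ℕ) : ℝ) ^ (aF k j))) / x)

noncomputable def vR (k : ℕ) (m : Fin (2 * k + 1) → ℕ+) : ℝ :=
  1 / ((∏ j, ((m j : ℕ) : ℝ) ^ (aF k j)) * (((∑ j, (m j : ℕ)) : ℕ) : ℝ) ^ 1)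

lemma fV_meas (k : ℕ) : Measurable (fV k) := by
  unfold fV
  refine Measurable.tsum fun m => ?_
  fun_prop

lemma fV_int (k : ℕ) : ∫⁻ x in Set.Ioo (0 : ℝ) 1, fV k x = ∑' m, ENNReal.ofReal (vR k m) := by
  unfold fV
  rw [lintegral_tsum (fun m => by fun_prop)]
  refine tsum_congr fun m => ?_
  obtain ⟨N, hN⟩ : ∃ N : ℕ, ∑ j, (m j : ℕ) = N + 1 := by
    have : 0 < ∑ j, (m j : ℕ) := Finset.sum_pos (fun j _ => (m j).pos) ⟨0, by simp⟩
    exact ⟨_, (Nat.succ_pred_eq_of_pos this).symm⟩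
  set c : ℝ := 1 / ∏ j, ((m j : ℕ) : ℝ) ^ (aF k j) with hc
  have hc0 : 0 ≤ c := by positivity
  have h := logI N 0
  have e : vR k m = c * (1 / ((N : ℝ) + 1)) := by
    rw [vR, hN, hc, one_div_mul_one_div, pow_one]; push_cast; rfl
  rw [e, ENNReal.ofReal_mul hc0]
  have h' : ENNReal.ofReal (1 / ((N : ℝ) + 1)) =
      ∫⁻ y in Set.Ioo (0 : ℝ) 1, ENNReal.ofReal (y ^ N * (-Real.log y) ^ 0) := by
    rw [h]; simp
  rw [h', ← lintegral_const_mul' _ _ ENNReal.ofReal_ne_top]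
  refine setLIntegral_congr_fun measurableSet_Ioo fun x hx => ?_
  rw [← ENNReal.ofReal_mul hc0, Finset.prod_div_distrib, Finset.prod_pow_eq_pow_sum, hN, hc]
  congr 1
  have := hx.1.ne'
  rw [pow_succ]
  field_simp

lemma tsum_pnat_Lis (s : ℕ) {x : ℝ} (h0 : 0 < x) (h1 : x < 1) :
    ∑' n : ℕ+, ENNReal.ofReal (x ^ (n : ℕ) / ((n : ℕ) : ℝ) ^ s) = ENNReal.ofReal (Lis s x) := by
  rw [tsum_pnat_eq_tsum_succ (f := fun n : ℕ => ENNReal.ofReal (x ^ n / (n : ℝ) ^ s)), Lis,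
    ENNReal.ofReal_tsum_of_nonneg (fun n => by positivity) (Lis_summable s h0.le h1)]
  simp

lemma fV_eq (k : ℕ) {x : ℝ} (h0 : 0 < x) (h1 : x < 1) :
    fV k x = ENNReal.ofReal (Lis 2 x * (-Real.log (1 - x)) ^ (2 * k) / x) := by
  unfold fV
  have e : ∀ m : Fin (2 * k + 1) → ℕ+,
      ENNReal.ofReal ((∏ j, (x ^ (m j : ℕ) / ((m j : ℕ) : ℝ) ^ (aF k j))) / x) =
      (∏ j, ENNReal.ofReal (x ^ (m j : ℕ) / ((m j : ℕ) : ℝ) ^ (aF k j))) * ENNReal.ofReal x⁻¹ := by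
    intro m
    rw [div_eq_mul_inv, ENNReal.ofReal_mul (Finset.prod_nonneg fun j _ => by positivity),
      ENNReal.ofReal_prod_of_nonneg (fun j _ => by positivity)]
  simp_rw [e]
  rw [ENNReal.tsum_mul_right,
    tsum_pi_prod _ (fun j n => ENNReal.ofReal (x ^ (n : ℕ) / ((n : ℕ) : ℝ) ^ (aF k j)))]
  simp_rw [tsum_pnat_Lis _ h0 h1]
  rw [← ENNReal.ofReal_prod_of_nonneg (fun j _ => Lis_nonneg _ h0.le),
    ← ENNReal.ofReal_mul (Finset.prod_nonneg fun j _ => Lis_nonneg _ h0.le), Fin.prod_univ_succ]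
  congr 1
  simp [aF, Lis_one h0.le h1, div_eq_mul_inv]

lemma fV_flip (k : ℕ) : ∫⁻ x in Set.Ioo (0 : ℝ) 1, fV k x =
    ∫⁻ y in Set.Ioo (0 : ℝ) 1, fV k (1 - y) := by
  have himg : (fun y : ℝ => 1 - y) '' Set.Ioo 0 1 = Set.Ioo 0 1 := by simp
  conv_lhs => rw [← himg]
  rw [lintegral_image_eq_lintegral_abs_deriv_mul (f' := fun t => -1) measurableSet_Ioo]
  · simp
  · intro t _
    have := ((hasDerivAt_id t).const_sub 1).hasDerivWithinAt (s := Set.Ioo 0 1)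
    simpa using this
  · intro a _ b _ h
    simpa using h

noncomputable def fH (s e : ℕ) (y : ℝ) : ENNReal :=
  ∑' n : ℕ, ENNReal.ofReal (Hr s (n + 1) * (y ^ (n + 1) * (-Real.log y) ^ e))

lemma fH_eq (s e : ℕ) {y : ℝ} (h0 : 0 < y) (h1 : y < 1) :
    fH s e y = ENNReal.ofReal (Lis s y / (1 - y) * (-Real.log y) ^ e) := by
  have hl : 0 ≤ -Real.log y := by have := Real.log_neg h0 h1; linarith
  have h := (Lis_geom s h0 h1).mul_right ((-Real.log y) ^ e)
  rw [fH, ← h.tsum_eq, ENNReal.ofReal_tsum_of_nonneg _ h.summable]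
  · simp_rw [mul_assoc]
  · intro n
    have := Hr_nonneg s (n + 1)
    positivity

lemma Hshift {s t : ℕ} (ht : 3 ≤ t) :
    HasSum (fun n : ℕ => Hr s (n + 1) / (((n + 1 : ℕ) : ℝ) + 1) ^ t)
      (∑' j : ℕ, Hr s j / ((j : ℝ) + 1) ^ t) := by
  have h := (Hr_summable (s := s) ht)
  have := (hasSum_nat_add_iff' 1).2 h.hasSum
  simpa [Hr] using this

lemma fH_meas (s e : ℕ) : Measurable (fH s e) := by
  unfold fH
  refine Measurable.tsum fun m => ?_
  fun_prop

lemma fH_int (s e : ℕ) (he : 2 ≤ e) : ∫⁻ x in Set.Ioo (0 : ℝ) 1, fH s e x =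
    ENNReal.ofReal ((e.factorial : ℝ) * ∑' j : ℕ, Hr s j / ((j : ℝ) + 1) ^ (e + 1)) := by
  unfold fH
  have hs := (Hshift (s := s) (show 3 ≤ e + 1 by omega)).mul_left (e.factorial : ℝ)
  rw [lintegral_tsum (fun m => by fun_prop), ← hs.tsum_eq,
    ENNReal.ofReal_tsum_of_nonneg _ hs.summable]
  · refine tsum_congr fun n => ?_
    have := Hr_nonneg s (n + 1)
    simp_rw [ENNReal.ofReal_mul this]
    rw [lintegral_const_mul' _ _ ENNReal.ofReal_ne_top, logI, ← ENNReal.ofReal_mul this]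
    congr 1
    ring
  · intro n
    have := Hr_nonneg s (n + 1)
    positivity

noncomputable def fZ (e : ℕ) (y : ℝ) : ENNReal :=
  ∑' n : ℕ, ENNReal.ofReal (y ^ n * (-Real.log y) ^ e)

lemma fZ_eq (e : ℕ) {y : ℝ} (h0 : 0 < y) (h1 : y < 1) :
    fZ e y = ENNReal.ofReal (1 / (1 - y) * (-Real.log y) ^ e) := by
  have hl : 0 ≤ -Real.log y := by have := Real.log_neg h0 h1; linarith
  have h := (hasSum_geometric_of_lt_one h0.le h1).mul_right ((-Real.log y) ^ e)
  rw [fZ, one_div, ← h.tsum_eq, ENNReal.ofReal_tsum_of_nonneg _ h.summable]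
  intro n
  positivity

lemma fZ_int (e : ℕ) (he : 2 ≤ e) : ∫⁻ x in Set.Ioo (0 : ℝ) 1, fZ e x =
    ENNReal.ofReal ((e.factorial : ℝ) * Zr (e + 1)) := by
  unfold fZ
  have hs := (Zr_summable (show 2 ≤ e + 1 by omega)).hasSum.mul_left (e.factorial : ℝ)
  rw [← Zr] at hs
  rw [lintegral_tsum (fun m => by fun_prop), ← hs.tsum_eq,
    ENNReal.ofReal_tsum_of_nonneg _ hs.summable]
  · refine tsum_congr fun n => ?_
    rw [logI]
    congr 1
    ring
  · intro n
    positivity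

lemma key_pt (k : ℕ) {y : ℝ} (h0 : 0 < y) (h1 : y < 1) :
    fV k (1 - y) + (fH 1 (2 * k + 1) y + fH 2 (2 * k) y) =
      ENNReal.ofReal (Zr 2) * fZ (2 * k) y := by
  have hl : 0 ≤ -Real.log y := by have := Real.log_neg h0 h1; linarith
  have hy : 0 < 1 - y := by linarith
  have hL1 := Lis_nonneg 1 h0.le
  have hL2 := Lis_nonneg 2 h0.le
  have hL3 := Lis_nonneg 2 hy.le
  have hZ : 0 ≤ Zr 2 := tsum_nonneg fun n => by positivity
  rw [fV_eq k hy (by linarith), fH_eq _ _ h0 h1, fH_eq _ _ h0 h1, fZ_eq _ h0 h1,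
    ← ENNReal.ofReal_mul hZ, sub_sub_cancel,
    ← ENNReal.ofReal_add (by positivity) (by positivity),
    ← ENNReal.ofReal_add (by positivity) (by positivity)]
  congr 1
  rw [← Lis_refl h0 h1, Lis_one h0.le h1, pow_succ]
  field_simp
  ring

theorem partA (k : ℕ) (hk : 1 ≤ k) :
    (∑' m, vR k m) = ((2 * k).factorial : ℝ) * (Zr 2 * Zr (2 * k + 1)
      - (2 * (k : ℝ) + 1) * (∑' j : ℕ, Hr 1 j / ((j : ℝ) + 1) ^ (2 * k + 2))
      - ∑' j : ℕ, Hr 2 j / ((j : ℝ) + 1) ^ (2 * k + 1)) := by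
  have hZ : ∀ s, 0 ≤ Zr s := fun s => tsum_nonneg fun n => by positivity
  have hE : ∀ s t : ℕ, 0 ≤ ∑' j : ℕ, Hr s j / ((j : ℝ) + 1) ^ t := fun s t =>
    tsum_nonneg fun j => div_nonneg (Hr_nonneg _ _) (by positivity)
  have h1 := hE 1 (2 * k + 2)
  have h2 := hE 2 (2 * k + 1)
  have hz := hZ (2 * k + 1)
  have h : ∫⁻ y in Set.Ioo (0 : ℝ) 1,
      (fV k (1 - y) + (fH 1 (2 * k + 1) y + fH 2 (2 * k) y)) =
      ∫⁻ y in Set.Ioo (0 : ℝ) 1, ENNReal.ofReal (Zr 2) * fZ (2 * k) y :=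
    setLIntegral_congr_fun measurableSet_Ioo fun y hy => key_pt k hy.1 hy.2
  have hm : Measurable fun y : ℝ => fV k (1 - y) :=
    (fV_meas k).comp (measurable_const.sub measurable_id)
  rw [lintegral_add_left hm, lintegral_add_left (fH_meas _ _),
    lintegral_const_mul' _ _ ENNReal.ofReal_ne_top, ← fV_flip, fV_int, fH_int _ _ (by omega),
    fH_int _ _ (by omega), fZ_int _ (by omega), ← ENNReal.ofReal_mul (hZ 2),
    ← ENNReal.ofReal_add (by positivity) (by positivity)] at h
  have hfin : ∑' m, ENNReal.ofReal (vR k m) ≠ ⊤ := by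
    intro htop
    rw [htop, top_add] at h
    exact ENNReal.ofReal_ne_top h.symm
  have hr := congrArg ENNReal.toReal h
  rw [ENNReal.toReal_add hfin ENNReal.ofReal_ne_top,
    ENNReal.tsum_toReal_eq (fun _ => ENNReal.ofReal_ne_top),
    ENNReal.toReal_ofReal (by positivity),
    ENNReal.toReal_ofReal (mul_nonneg (hZ 2) (by positivity))] at hr
  have hv : ∀ m, (ENNReal.ofReal (vR k m)).toReal = vR k m := fun m =>
    ENNReal.toReal_ofReal (by unfold vR; positivity)
  simp_rw [hv] at hr
  rw [Nat.factorial_succ] at hr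
  push_cast at hr
  linear_combination hr
end

lemma Zr_zeta {s : ℕ} (hs : 2 ≤ s) : riemannZeta (s : ℂ) = ((Zr s : ℝ) : ℂ) := by
  rw [zeta_nat_eq_tsum_of_gt_one (by omega), Zr]
  have h : Summable fun n : ℕ => 1 / (n : ℝ) ^ s := Real.summable_one_div_nat_pow.2 (by omega)
  have e := h.tsum_eq_zero_add
  rw [show ((0 : ℕ) : ℝ) = 0 by simp, zero_pow (by omega), div_zero, zero_add] at e
  have e2 : ∑' n : ℕ, 1 / (n : ℂ) ^ s = ((∑' n : ℕ, 1 / (n : ℝ) ^ s : ℝ) : ℂ) := by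
    rw [Complex.ofReal_tsum]; push_cast; rfl
  rw [e2, e]
  push_cast; rfl

theorem stmt_5 (k : ℕ) (hk : 1 ≤ k) :
    zMTn (2 * k + 1) (fun i => if (i : ℕ) = 0 then 2 else 1) 1 =
      ((2 * k).factorial : ℂ) *
        (riemannZeta 2 * riemannZeta (2 * k + 1)
          - (1 / 2) * (2 * (k : ℂ) ^ 2 + k - 2) * riemannZeta (2 * k + 3)
          + ∑ n ∈ Finset.Icc 1 (k - 1),
              ((2 * k + 1 - 2 * n : ℕ) : ℂ) * riemannZeta (2 * n + 1)
                * riemannZeta (2 * k + 2 - 2 * n)) := by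
  have hV : zMTn (2 * k + 1) (fun i => if (i : ℕ) = 0 then 2 else 1) 1 =
      ((∑' m, vR k m : ℝ) : ℂ) := by
    rw [zMTn, Complex.ofReal_tsum]
    refine tsum_congr fun m => ?_
    simp only [vR, aF]
    push_cast
    rfl
  have z2 : riemannZeta 2 = ((Zr 2 : ℝ) : ℂ) := by
    rw [← Zr_zeta le_rfl]; norm_num
  have z1 : riemannZeta (2 * k + 1) = ((Zr (2 * k + 1) : ℝ) : ℂ) := by
    rw [← Zr_zeta (by omega)]; push_cast; rfl
  have z3 : riemannZeta (2 * k + 3) = ((Zr (2 * k + 3) : ℝ) : ℂ) := by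
    rw [← Zr_zeta (by omega)]; push_cast; rfl
  have hsum : ∑ n ∈ Finset.Icc 1 (k - 1),
      ((2 * k + 1 - 2 * n : ℕ) : ℂ) * riemannZeta (2 * n + 1)
        * riemannZeta (2 * k + 2 - 2 * n) =
      ((∑ n ∈ range (k - 1), (2 * (k : ℝ) - 1 - 2 * n) * (Zr (2 * n + 3) * Zr (2 * k - 2 * n)) : ℝ)
        : ℂ) := by
    rw [← Finset.Ico_succ_right_eq_Icc, Finset.sum_Ico_eq_sum_range]
    push_cast
    refine Finset.sum_congr (by simp) fun n hn => ?_
    have hn' : n < k - 1 := by simpa using hn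
    rw [← Zr_zeta (by omega), ← Zr_zeta (by omega), Nat.cast_sub (by omega),
      Nat.cast_sub (by omega)]
    push_cast
    rw [show (2 : ℂ) * (1 + n) + 1 = 2 * n + 3 by ring,
      show (2 : ℂ) * k + 2 - 2 * (1 + n) = 2 * k - 2 * n by ring]
    ring
  rw [hV, z1, z2, z3, hsum, partA k hk]
  have hB := partB k hk
  obtain ⟨l, rfl⟩ : ∃ l, k = l + 1 := ⟨k - 1, by omega⟩
  rw [sum_range_succ, show 2 * (l + 1) - 2 * l = 2 by omega,
    show 2 * l + 3 = 2 * (l + 1) + 1 by ring] at hB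
  rw [Nat.add_sub_cancel]
  generalize ∑ n ∈ range l, (2 * ((l + 1 : ℕ) : ℝ) - 1 - 2 * n) *
    (Zr (2 * n + 3) * Zr (2 * (l + 1) - 2 * n)) = S at *
  have hR := congrArg (fun t : ℝ => (((2 * (l + 1)).factorial : ℝ) : ℂ) * (t : ℂ)) hB
  push_cast at hR ⊢
  linear_combination -hR
end

section
/- For r ∈ ℕ with r ≥ 1 and s ∈ ℂ with Re(s) > 1, the following identity between absolutely convergent quantities holds: ∑_{j=0}^{r−1} C(r−1,j)·(−1)^j·ζ(2)^{r−1−j}·ξ_{MT}((2,...,2) with j twos; s) = ∑_{j=0}^{r−1} C(r−1,j)·(s)_j·ζ_{MT,r}(2,...,2,1,...,1,0; s+j), where on the right there are r−1−j twos and j ones before the 0, and (s)_j = s(s+1)···(s+j−1) is the Pochhammer symbol. -/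
open scoped BigOperators

/-- The polylogarithm `Li_k(z) = ∑_{m ≥ 1} z^m / m^k`. -/
noncomputable def Li (k : ℕ) (z : ℂ) : ℂ := ∑' m : ℕ+, z ^ (m : ℕ) / ((m : ℕ) : ℂ) ^ k

/-- The Mordell–Tornheim analogue of the Arakawa–Kaneko zeta function;
for an empty tuple (`n = 0`) the product is `1` and this equals `ζ(s)` for `Re s > 1`. -/
noncomputable def xiMT (n : ℕ) (k : Fin n → ℕ) (s : ℂ) : ℂ :=
  (1 / Complex.Gamma s) *
    ∫ t in Set.Ioi (0 : ℝ),
      (t : ℂ) ^ (s - 1) / ((Real.exp t : ℂ) - 1) * ∏ i, Li (k i) (1 - Real.exp (-t))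

/-- Mordell–Tornheim zeta with natural first exponents and complex last exponent. -/
noncomputable def zMTm (r : ℕ) (a : Fin r → ℕ) (c : ℂ) : ℂ :=
  ∑' m : Fin r → ℕ+,
    1 / ((∏ j, ((m j : ℕ) : ℂ) ^ (a j)) * (((∑ j, (m j : ℕ)) : ℕ) : ℂ) ^ c)

open Filter Topology Set MeasureTheory

noncomputable def Dl (x : ℝ) : ℝ := ∑' n : ℕ, x ^ (n + 1) / ((n : ℝ) + 1) ^ 2

lemma summ_sq : Summable (fun n : ℕ => 1 / ((n : ℝ) + 1) ^ 2) := by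
  have := (summable_nat_add_iff 1).2 (Real.summable_one_div_nat_pow.2 (one_lt_two))
  simpa using this

lemma Dl_term_le {x : ℝ} (hx : x ∈ Icc (0:ℝ) 1) (n : ℕ) :
    ‖x ^ (n + 1) / ((n : ℝ) + 1) ^ 2‖ ≤ 1 / ((n : ℝ) + 1) ^ 2 := by
  have h0 : 0 ≤ x ^ (n + 1) := pow_nonneg hx.1 _
  rw [Real.norm_of_nonneg (by positivity)]
  gcongr
  exact pow_le_one₀ hx.1 hx.2

lemma Dl_summable {x : ℝ} (hx : x ∈ Icc (0:ℝ) 1) :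
    Summable (fun n : ℕ => x ^ (n + 1) / ((n : ℝ) + 1) ^ 2) :=
  .of_norm_bounded summ_sq (Dl_term_le hx)

lemma Dl_cont : ContinuousOn Dl (Icc 0 1) := by
  unfold Dl
  refine continuousOn_tsum (fun n => ?_) summ_sq (fun n x hx => Dl_term_le hx n)
  fun_prop

lemma Dl_zero : Dl 0 = 0 := by simp [Dl]

lemma Dl_nonneg {x : ℝ} (hx : x ∈ Icc (0:ℝ) 1) : 0 ≤ Dl x :=
  tsum_nonneg fun n => div_nonneg (pow_nonneg hx.1 _) (by positivity)

lemma Dl_le {x : ℝ} (hx : x ∈ Icc (0:ℝ) 1) : Dl x ≤ Dl 1 := by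
  refine Summable.tsum_le_tsum (fun n => ?_) (Dl_summable hx) (Dl_summable (by simp))
  gcongr
  · exact hx.1
  · exact hx.2

lemma Dl_deriv {x : ℝ} (hx : x ∈ Ioo (0:ℝ) 1) : HasDerivAt Dl (-Real.log (1 - x) / x) x := by
  obtain ⟨y, hxy, hy⟩ := exists_between hx.2
  have hy0 : 0 < y := hx.1.trans hxy
  have key := hasDerivAt_tsum_of_isPreconnected (𝕜 := ℝ) (t := Ioo 0 y) (y₀ := x) (y := x)
    (g := fun (n : ℕ) (x : ℝ) => x ^ (n + 1) / ((n : ℝ) + 1) ^ 2)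
    (g' := fun (n : ℕ) (x : ℝ) => x ^ n / ((n : ℝ) + 1)) (u := fun n => y ^ n)
    (summable_geometric_of_lt_one hy0.le hy) isOpen_Ioo isPreconnected_Ioo ?_ ?_
    ⟨hx.1, hxy⟩ (Dl_summable ⟨hx.1.le, hx.2.le⟩) ⟨hx.1, hxy⟩
  · refine key.congr_deriv ?_
    have h := (Real.hasSum_pow_div_log_of_abs_lt_one (x := x)
      (by rw [abs_of_pos hx.1]; exact hx.2)).div_const x
    rw [← h.tsum_eq]
    refine tsum_congr fun n => ?_
    have := hx.1.ne'
    rw [pow_succ]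
    field_simp
  · intro n z hz
    refine ((hasDerivAt_pow (n + 1) z).div_const _).congr_deriv ?_
    push_cast
    field_simp
    try rfl
  · intro n z hz
    have h0 : 0 ≤ z ^ n := pow_nonneg hz.1.le _
    rw [Real.norm_of_nonneg (by positivity)]
    calc z ^ n / ((n : ℝ) + 1) ≤ z ^ n / 1 := by gcongr; simp
      _ ≤ y ^ n := by rw [div_one]; exact pow_le_pow_left₀ hz.1.le hz.2.le n

lemma log_log_tendsto :
    Tendsto (fun x : ℝ => Real.log x * Real.log (1 - x)) (𝓝[>] 0) (𝓝 0) := by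
  have h1 : Tendsto (fun x : ℝ => Real.log x * x) (𝓝[>] 0) (𝓝 0) := by
    simpa using tendsto_log_mul_rpow_nhdsGT_zero one_pos
  have h2 : HasDerivAt (fun x : ℝ => Real.log (1 - x)) (-1) 0 := by
    have := ((hasDerivAt_id (0:ℝ)).const_sub 1).log (by simp)
    simpa using this
  have h3 := (hasDerivAt_iff_tendsto_slope.1 h2).mono_left
    (nhdsWithin_mono (0:ℝ) (s := Ioi 0) (fun x hx => ne_of_gt hx))
  have h4 := h1.mul h3
  rw [zero_mul] at h4
  refine h4.congr' ?_
  filter_upwards [self_mem_nhdsWithin] with x hx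
  have : x ≠ 0 := ne_of_gt hx
  simp [slope_def_field]
  field_simp

lemma Dl_reflect {x : ℝ} (hx : x ∈ Ioo (0:ℝ) 1) :
    Dl x + Dl (1 - x) + Real.log x * Real.log (1 - x) = Dl 1 := by
  set F : ℝ → ℝ := fun x => Dl x + Dl (1 - x) + Real.log x * Real.log (1 - x) with hF
  have hd : ∀ y ∈ Ioo (0:ℝ) 1, HasDerivAt F 0 y := by
    intro y hy
    have hy' : 1 - y ∈ Ioo (0:ℝ) 1 := ⟨by linarith [hy.2], by linarith [hy.1]⟩
    have e1 := Dl_deriv hy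
    have hs : HasDerivAt (fun y : ℝ => 1 - y) (-1) y := (hasDerivAt_id y).const_sub 1
    have e2 := HasDerivAt.comp y (Dl_deriv hy') hs
    have e3 := (Real.hasDerivAt_log hy.1.ne').mul (hs.log hy'.1.ne')
    refine ((e1.add e2).add e3).congr_deriv ?_
    have a1 := hy.1.ne'
    have a2 := hy'.1.ne'
    rw [show 1 - (1 - y) = y by ring]
    field_simp
    ring
  have hc : ∀ y ∈ Ioo (0:ℝ) 1, F y = F x := by
    intro y hy
    exact (isOpen_Ioo).is_const_of_deriv_eq_zero isPreconnected_Ioo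
      (fun z hz => (hd z hz).differentiableAt.differentiableWithinAt)
      (fun z hz => (hd z hz).deriv) hy hx
  have hl : Tendsto F (𝓝[>] 0) (𝓝 (Dl 0 + Dl (1 - 0) + 0)) := by
    have hI : Ioo (0:ℝ) 1 ∈ 𝓝[>] (0:ℝ) := Ioo_mem_nhdsGT one_pos
    refine (Tendsto.add ?_ ?_).add log_log_tendsto
    · refine ((Dl_cont 0 (by simp)).tendsto).mono_left ?_
      exact nhdsWithin_le_of_mem (mem_of_superset hI Ioo_subset_Icc_self)
    · have : ContinuousOn (fun x : ℝ => Dl (1 - x)) (Icc 0 1) :=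
        Dl_cont.comp (by fun_prop) (fun x hx => ⟨by linarith [hx.2], by linarith [hx.1]⟩)
      refine ((this 0 (by simp)).tendsto).mono_left ?_
      exact nhdsWithin_le_of_mem (mem_of_superset hI Ioo_subset_Icc_self)
  have hl2 : Tendsto F (𝓝[>] 0) (𝓝 (F x)) := by
    refine tendsto_const_nhds.congr' ?_
    filter_upwards [Ioo_mem_nhdsGT one_pos] with y hy using (hc y hy).symm
  have := tendsto_nhds_unique hl2 hl
  simpa [Dl_zero] using this

lemma Li_two_ofReal (x : ℝ) : Li 2 (x : ℂ) = (Dl x : ℂ) := by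
  unfold Li Dl
  rw [tsum_pnat_eq_tsum_succ (f := fun n : ℕ => (x : ℂ) ^ n / (n : ℂ) ^ 2)]
  push_cast
  rfl

lemma zeta_two_eq : riemannZeta 2 = (Dl 1 : ℂ) := by
  have := zeta_eq_tsum_one_div_nat_add_one_cpow (s := 2) (by simp)
  rw [this, Dl]
  push_cast
  simp

lemma hasSum_two {α β : Type} (f : α → ℂ) (g : β → ℂ) (a b : ℂ) (hf : Summable fun x => ‖f x‖)
    (hg : Summable fun x => ‖g x‖) (ha : HasSum f a) (hb : HasSum g b) :
    HasSum (fun p : α × β => f p.1 * g p.2) (a * b) :=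
  HasSum.mul ha hb (summable_mul_of_summable_norm hf hg)

lemma hasSum_pi (n : ℕ) (f : Fin n → ℕ+ → ℂ) (hf : ∀ i, Summable fun k => ‖f i k‖) :
    Summable (fun m : Fin n → ℕ+ => ‖∏ i, f i (m i)‖) ∧
    HasSum (fun m : Fin n → ℕ+ => ∏ i, f i (m i)) (∏ i, ∑' k, f i k) := by
  induction n with
  | zero =>
    refine ⟨Summable.of_finite, ?_⟩
    simp only [Finset.univ_eq_empty, Finset.prod_empty]
    exact hasSum_unique (fun m : Fin 0 → ℕ+ => (1 : ℂ))
  | succ n ih =>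
    obtain ⟨h1, h2⟩ := ih (fun i => f i.succ) (fun i => hf _)
    constructor
    · rw [← (Fin.consEquiv (fun _ : Fin (n + 1) => ℕ+)).summable_iff]
      refine ((hf 0).mul_norm h1).congr ?_
      intro p
      simp [Fin.prod_univ_succ, Fin.consEquiv]
    · rw [← (Fin.consEquiv (fun _ : Fin (n + 1) => ℕ+)).hasSum_iff]
      rw [Fin.prod_univ_succ]
      have h4 := hasSum_two (f 0) _ _ _ (hf 0) h1 (hf 0).of_norm.hasSum h2
      refine h4.congr_fun fun p => ?_
      simp [Fin.prod_univ_succ, Fin.consEquiv]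
def ex (n j : ℕ) (i : Fin (n + 1)) : ℕ :=
  if (i : ℕ) < n - j then 2 else if (i : ℕ) < n then 1 else 0

lemma prod_ex {R : Type} [CommMonoid R] (P : ℕ → R) {n j : ℕ} (hj : j ≤ n) :
    ∏ i, P (ex n j i) = P 2 ^ (n - j) * P 1 ^ j * P 0 := by
  obtain ⟨k, rfl⟩ := Nat.exists_eq_add_of_le' hj
  rw [Fin.prod_univ_castSucc]
  congr 1
  · rw [Nat.add_sub_cancel]
    have : ∀ i : Fin (k + j), P (ex (k + j) j i.castSucc) =
        (fun i : ℕ => if i < k then P 2 else P 1) i := by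
      intro i
      have := i.2
      simp only [ex, Nat.add_sub_cancel, Fin.val_castSucc, this, if_true]
      split_ifs <;> rfl
    rw [Finset.prod_congr rfl (fun i _ => this i), Fin.prod_univ_eq_prod_range
      (fun i : ℕ => if i < k then P 2 else P 1), Finset.prod_range_add]
    congr 1
    · rw [Finset.prod_congr rfl (g := fun _ => P 2)]
      · simp
      · intro i hi
        simp [Finset.mem_range.1 hi]
    · simp
  · simp [ex]

/-- The three one-dimensional generating functions. -/
noncomputable def PF (t : ℝ) (a : ℕ) : ℝ :=
  if a = 2 then Dl (Real.exp (-t)) else if a = 1 then -Real.log (1 - Real.exp (-t))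
  else 1 / (Real.exp t - 1)

lemma exp_mem {t : ℝ} (ht : 0 < t) : Real.exp (-t) ∈ Ioo (0:ℝ) 1 :=
  ⟨Real.exp_pos _, by simpa using ht⟩

lemma PF_summable {t : ℝ} (ht : 0 < t) (a : ℕ) :
    Summable fun k : ℕ+ => ‖1 / ((k : ℕ) : ℂ) ^ a * (Real.exp (-((k : ℕ) : ℝ) * t) : ℂ)‖ := by
  have h := summable_geometric_of_lt_one (exp_mem ht).1.le (exp_mem ht).2
  have h2 : Summable fun k : ℕ+ => Real.exp (-t) ^ (k : ℕ) :=
    h.comp_injective PNat.coe_injective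
  refine Summable.of_nonneg_of_le (fun _ => norm_nonneg _) (fun k => ?_) h2
  rw [norm_mul, norm_div, norm_one, norm_pow, Complex.norm_natCast, Complex.norm_real,
    Real.norm_of_nonneg (Real.exp_pos _).le, ← Real.exp_nat_mul]
  have : 1 ≤ ((k : ℕ) : ℝ) ^ a := one_le_pow₀ (by exact_mod_cast k.2)
  calc _ ≤ 1 * Real.exp (-((k : ℕ) : ℝ) * t) := by
        gcongr
        exact (div_le_one (by positivity)).2 this
    _ = _ := by rw [one_mul]; ring_nf

lemma PF_tsum {t : ℝ} (ht : 0 < t) {a : ℕ} (ha : a ≤ 2) :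
    ∑' k : ℕ+, 1 / ((k : ℕ) : ℂ) ^ a * (Real.exp (-((k : ℕ) : ℝ) * t) : ℂ) = (PF t a : ℂ) := by
  have hx := exp_mem ht
  rw [tsum_pnat_eq_tsum_succ
    (f := fun n : ℕ => 1 / (n : ℂ) ^ a * (Real.exp (-(n : ℝ) * t) : ℂ))]
  have : ∀ n : ℕ, 1 / ((n + 1 : ℕ) : ℂ) ^ a * (Real.exp (-((n + 1 : ℕ) : ℝ) * t) : ℂ) =
      ((Real.exp (-t) ^ (n + 1) / ((n : ℝ) + 1) ^ a : ℝ) : ℂ) := by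
    intro n
    rw [← Real.exp_nat_mul]
    push_cast
    ring_nf
  simp_rw [this]
  rw [← Complex.ofReal_tsum]
  congr 1
  unfold PF
  interval_cases a
  · simp only [pow_zero, div_one]
    simp only [pow_succ]
    rw [tsum_mul_right, tsum_geometric_of_lt_one hx.1.le hx.2]
    simp
    have : Real.exp t - 1 ≠ 0 := by
      have : 1 < Real.exp t := by simpa using ht
      linarith
    rw [Real.exp_neg]
    have h2 := (Real.exp_pos t).ne'
    have h3 : 1 - (Real.exp t)⁻¹ ≠ 0 := by
      have := hx.2
      rw [Real.exp_neg] at this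
      linarith
    field_simp
  · simp only [pow_one]
    simpa using (Real.hasSum_pow_div_log_of_abs_lt_one
      (by rw [abs_of_pos hx.1]; exact hx.2)).tsum_eq
  · simp [Dl]

lemma ex_le (n j : ℕ) (i : Fin (n + 1)) : ex n j i ≤ 2 := by
  unfold ex; split_ifs <;> simp

lemma pf_hasSum {n j : ℕ} (hj : j ≤ n) {t : ℝ} (ht : 0 < t) :
    HasSum (fun m : Fin (n + 1) → ℕ+ => (∏ i, 1 / ((m i : ℕ) : ℂ) ^ (ex n j i)) *
      (Real.exp (-((∑ i, (m i : ℕ) : ℕ) : ℝ) * t) : ℂ))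
      (((PF t 2) ^ (n - j) * PF t 1 ^ j * PF t 0 : ℝ) : ℂ) := by
  have h := (hasSum_pi (n + 1) (fun i k => 1 / ((k : ℕ) : ℂ) ^ (ex n j i) *
    (Real.exp (-((k : ℕ) : ℝ) * t) : ℂ)) (fun i => PF_summable ht _)).2
  rw [Finset.prod_congr rfl (fun i _ => PF_tsum ht (ex_le n j i)),
    prod_ex (fun a => (PF t a : ℂ)) hj] at h
  convert h using 1
  · funext m
    rw [Finset.prod_mul_distrib]
    congr 1
    rw [← Complex.ofReal_prod, ← Real.exp_sum]
    congr 2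
    push_cast
    rw [neg_mul, Finset.sum_mul, ← Finset.sum_neg_distrib]
    simp
  · push_cast
    rfl

lemma ex_summable {n j : ℕ} (hj : j ≤ n) {σ : ℝ} (hσ : 1 < σ) :
    Summable fun m : Fin (n + 1) → ℕ+ => ‖∏ i, 1 / ((m i : ℕ) : ℂ) ^ (ex n j i)‖ /
      ((∑ i, (m i : ℕ) : ℕ) : ℝ) ^ (σ + j) := by
  set h : ℝ → ℕ → ℝ := fun x a => if a = 2 then 1 else if a = 1 then x else x ^ σ with hh
  have hpos : ∀ x > 0, ∀ a, 0 < h x a := by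
    intro x hx a
    simp only [hh]
    split_ifs <;> positivity
  have hmono : ∀ x y a, 0 < x → x ≤ y → h x a ≤ h y a := by
    intro x y a hx hxy
    simp only [hh]
    split_ifs
    · rfl
    · exact hxy
    · gcongr
  have hsum := (hasSum_pi (n + 1) (fun i k => ((1 / (((k : ℕ) : ℝ) ^ (ex n j i) *
    h ((k : ℕ) : ℝ) (ex n j i)) : ℝ) : ℂ)) ?_).1
  · refine Summable.of_nonneg_of_le (fun m => ?_) (fun m => ?_) hsum
    · positivity
    · set M : ℝ := ((∑ i, (m i : ℕ) : ℕ) : ℝ) with hM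
      have hmM : ∀ i, ((m i : ℕ) : ℝ) ≤ M := by
        intro i
        rw [hM]
        exact_mod_cast Finset.single_le_sum (f := fun i => (m i : ℕ)) (fun _ _ => Nat.zero_le _)
          (Finset.mem_univ i)
      have hm0 : ∀ i, 0 < ((m i : ℕ) : ℝ) := fun i => by exact_mod_cast (m i).2
      have hM0 : 0 < M := (hm0 0).trans_le (hmM 0)
      have e1 : M ^ (σ + j) = ∏ i, h M (ex n j i) := by
        rw [prod_ex (h M) hj, Real.rpow_add hM0, Real.rpow_natCast]
        simp [hh]
        ring
      rw [e1, norm_prod, norm_prod, ← Finset.prod_div_distrib]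
      refine Finset.prod_le_prod (fun i _ => ?_) (fun i _ => ?_)
      · exact div_nonneg (norm_nonneg _) (hpos M hM0 _).le
      · have p1 := hpos _ (hm0 i) (ex n j i)
        have p2 := hm0 i
        rw [Complex.norm_real, Real.norm_of_nonneg (by positivity), norm_div, norm_pow,
          Complex.norm_natCast, norm_one, div_div]
        gcongr
        exact hmono _ _ _ p2 (hmM i)
  · intro i
    have hs : ∀ a ≤ 2, Summable fun k : ℕ => 1 / ((k : ℝ) ^ a * h (k : ℝ) a) := by
      intro a ha
      interval_cases a
      · simpa [hh] using (Real.summable_one_div_nat_rpow.2 hσ)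
      · simpa [hh, ← sq] using (Real.summable_one_div_nat_pow.2 one_lt_two)
      · simpa [hh] using (Real.summable_one_div_nat_pow.2 one_lt_two)
    have := ((hs _ (ex_le n j i)).norm).comp_injective PNat.coe_injective
    simp only [Complex.norm_real]
    exact this

lemma mellin_eq {n j : ℕ} (hj : j ≤ n) {s : ℂ} (hs : 1 < s.re) :
    mellin (fun t => (((PF t 2) ^ (n - j) * PF t 1 ^ j * PF t 0 : ℝ) : ℂ)) (s + j) =
      Complex.Gamma (s + j) * zMTm (n + 1) (ex n j) (s + j) := by
  have h := hasSum_mellin (a := fun m : Fin (n + 1) → ℕ+ => ∏ i, 1 / ((m i : ℕ) : ℂ) ^ (ex n j i))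
    (p := fun m => ((∑ i, (m i : ℕ) : ℕ) : ℝ)) (s := s + j) (F := _) ?_ ?_
    (fun t ht => pf_hasSum hj ht) ?_
  · rw [← h.tsum_eq, zMTm, ← tsum_mul_left]
    refine tsum_congr fun m => ?_
    rw [Finset.prod_div_distrib, Finset.prod_const_one, mul_div_assoc, div_div]
    norm_cast
  · intro m
    right
    have : 0 < ∑ i, (m i : ℕ) := Finset.sum_pos (fun i _ => (m i).2) ⟨0, Finset.mem_univ _⟩
    exact_mod_cast this
  · simp
    positivity
  · simpa using ex_summable hj hs

lemma base_int {s : ℂ} (hs : 1 < s.re) :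
    IntegrableOn (fun t : ℝ => (t : ℂ) ^ (s - 1) * ((1 / (Real.exp t - 1) : ℝ) : ℂ)) (Ioi 0) := by
  have hne : ∀ t ∈ Ioi (0:ℝ), Real.exp t - 1 ≠ 0 := by
    intro t ht
    have : 1 < Real.exp t := by simpa using ht
    linarith
  have := mellinConvergent_of_isBigO_rpow_exp (a := 1) (b := 1) one_pos
    (f := fun t : ℝ => ((1 / (Real.exp t - 1) : ℝ) : ℂ)) (s := s) ?_ ?_ ?_ hs
  · exact this
  · refine ContinuousOn.locallyIntegrableOn ?_ measurableSet_Ioi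
    refine Complex.continuous_ofReal.comp_continuousOn ?_
    exact continuousOn_const.div (by fun_prop) hne
  · refine Asymptotics.IsBigO.of_bound 2 ?_
    filter_upwards [eventually_ge_atTop 1] with t ht
    have h2 : 2 ≤ Real.exp t := by linarith [Real.add_one_le_exp t]
    rw [Complex.norm_real, Real.norm_of_nonneg (by apply div_nonneg <;> linarith),
      Real.norm_of_nonneg (Real.exp_pos _).le, neg_one_mul, Real.exp_neg,
      div_le_iff₀ (by linarith)]
    have : (Real.exp t)⁻¹ * Real.exp t = 1 := inv_mul_cancel₀ (by positivity)
    have : (Real.exp t)⁻¹ ≤ 1 / 2 := by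
      rw [one_div]; exact inv_anti₀ (by norm_num) h2
    nlinarith
  · refine Asymptotics.IsBigO.of_bound 1 ?_
    filter_upwards [self_mem_nhdsWithin] with t ht
    have ht : 0 < t := ht
    have := Real.add_one_le_exp t
    rw [Complex.norm_real, Real.norm_of_nonneg (by apply div_nonneg <;> linarith),
      Real.norm_of_nonneg (by positivity), Real.rpow_neg_one, one_mul, ← one_div]
    exact one_div_le_one_div_of_le ht (by linarith)

lemma bdd_int {s : ℂ} (hs : 1 < s.re) (g : ℝ → ℝ) (C : ℝ) (hg : ContinuousOn g (Ioi 0))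
    (hC : ∀ t ∈ Ioi (0:ℝ), |g t| ≤ C) :
    IntegrableOn (fun t : ℝ => (t : ℂ) ^ (s - 1) * ((1 / (Real.exp t - 1) : ℝ) : ℂ) * (g t : ℂ))
      (Ioi 0) := by
  refine Integrable.mul_bdd (c := C) (base_int hs) ?_ ?_
  · exact (Complex.continuous_ofReal.comp_continuousOn hg).aestronglyMeasurable measurableSet_Ioi
  · refine (ae_restrict_iff' measurableSet_Ioi).2 (ae_of_all _ fun t ht => ?_)
    simpa using hC t ht

lemma cA : ContinuousOn (fun t : ℝ => PF t 2) (Ioi 0) := by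
  simp only [PF, if_true]
  exact Dl_cont.comp (by fun_prop) fun t ht => Ioo_subset_Icc_self (exp_mem ht)

lemma cC : ContinuousOn (fun t : ℝ => Dl (1 - Real.exp (-t))) (Ioi 0) := by
  refine Dl_cont.comp (by fun_prop) fun t ht => ?_
  have := exp_mem ht
  exact ⟨by linarith [this.2], by linarith [this.1]⟩

lemma cB : ContinuousOn (fun t : ℝ => t * PF t 1) (Ioi 0) := by
  simp only [PF]
  norm_num
  have hc : ContinuousOn (fun t : ℝ => 1 - Real.exp (-t)) (Ioi 0) := by fun_prop
  refine (continuousOn_id.mul (ContinuousOn.log hc ?_)).neg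
  intro t ht
  have := exp_mem ht
  linarith [this.2]

lemma bA {t : ℝ} (ht : t ∈ Ioi (0:ℝ)) : |PF t 2| ≤ Dl 1 := by
  have := Ioo_subset_Icc_self (exp_mem ht)
  simp only [PF, if_true]
  rw [abs_of_nonneg (Dl_nonneg this)]
  exact Dl_le this

lemma bC {t : ℝ} (ht : t ∈ Ioi (0:ℝ)) : |Dl (1 - Real.exp (-t))| ≤ Dl 1 := by
  have h := exp_mem ht
  have : 1 - Real.exp (-t) ∈ Icc (0:ℝ) 1 := ⟨by linarith [h.2], by linarith [h.1]⟩
  rw [abs_of_nonneg (Dl_nonneg this)]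
  exact Dl_le this

lemma refl' {t : ℝ} (ht : t ∈ Ioi (0:ℝ)) :
    t * PF t 1 + PF t 2 = -Dl (1 - Real.exp (-t)) + Dl 1 := by
  have := Dl_reflect (exp_mem ht)
  rw [Real.log_exp] at this
  simp [PF]
  linarith

lemma bB {t : ℝ} (ht : t ∈ Ioi (0:ℝ)) : |t * PF t 1| ≤ 3 * Dl 1 := by
  have h1 := refl' ht
  have h2 := abs_le.1 (bA ht)
  have h3 := abs_le.1 (bC ht)
  rw [abs_le]
  constructor <;> linarith

lemma gam (s : ℂ) (hs : 1 < s.re) (j : ℕ) :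
    Complex.Gamma (s + j) = Complex.Gamma s * ∏ i ∈ Finset.range j, (s + (i : ℂ)) := by
  induction j with
  | zero => simp
  | succ j ih =>
    rw [Finset.prod_range_succ, ← mul_assoc, ← ih]
    push_cast
    rw [← add_assoc, Complex.Gamma_add_one, mul_comm]
    intro h
    have := congrArg Complex.re h
    simp at this
    have : (0:ℝ) ≤ j := Nat.cast_nonneg j
    linarith

theorem main (n : ℕ) (s : ℂ) (hs : 1 < s.re) :
    (∑ j ∈ Finset.range (n + 1),
        (n.choose j : ℂ) * (-1) ^ j * (riemannZeta 2) ^ (n - j) *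
          xiMT j (fun _ => 2) s) =
      ∑ j ∈ Finset.range (n + 1),
        (n.choose j : ℂ) * (∏ i ∈ Finset.range j, (s + (i : ℂ))) *
          zMTm (n + 1) (ex n j) (s + (j : ℂ)) := by
  have hG : Complex.Gamma s ≠ 0 := Complex.Gamma_ne_zero_of_re_pos (by linarith)
  set G : ℝ → ℂ := fun t => (t : ℂ) ^ (s - 1) * ((1 / (Real.exp t - 1) : ℝ) : ℂ) with hGd
  have hxi : ∀ j : ℕ, xiMT j (fun _ => 2) s = (1 / Complex.Gamma s) *
      ∫ t in Ioi (0:ℝ), G t * ((Dl (1 - Real.exp (-t)) ^ j : ℝ) : ℂ) := by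
    intro j
    unfold xiMT
    congr 1
    refine setIntegral_congr_fun measurableSet_Ioi fun t ht => ?_
    have : Li 2 (1 - (Real.exp (-t) : ℂ)) = (Dl (1 - Real.exp (-t)) : ℂ) := by
      rw [← Li_two_ofReal]; push_cast; rfl
    simp only [Finset.prod_const, Finset.card_univ, Fintype.card_fin]
    rw [this]
    simp only [hGd]
    push_cast
    ring
  have hz : ∀ j ∈ Finset.range (n + 1), (∏ i ∈ Finset.range j, (s + (i : ℂ))) *
      zMTm (n + 1) (ex n j) (s + (j : ℂ)) = (1 / Complex.Gamma s) *
      ∫ t in Ioi (0:ℝ), G t * (((t * PF t 1) ^ j * PF t 2 ^ (n - j) : ℝ) : ℂ) := by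
    intro j hj
    have hj : j ≤ n := Nat.lt_succ_iff.1 (Finset.mem_range.1 hj)
    have h1 := mellin_eq hj hs
    rw [gam s hs, mul_assoc] at h1
    rw [one_div, eq_inv_mul_iff_mul_eq₀ hG, ← h1, mellin]
    refine setIntegral_congr_fun measurableSet_Ioi fun t ht => ?_
    have ht0 : (t : ℂ) ≠ 0 := by exact_mod_cast (ne_of_gt ht)
    have : (t : ℂ) ^ (s + j - 1) = (t : ℂ) ^ (s - 1) * (t : ℂ) ^ j := by
      rw [show s + j - 1 = (s - 1) + j by ring, Complex.cpow_add _ _ ht0, Complex.cpow_natCast]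
    simp only [smul_eq_mul, this, hGd]
    have h0 : PF t 0 = 1 / (Real.exp t - 1) := by simp [PF]
    rw [h0]
    push_cast
    ring
  have iL : ∀ j : ℕ, IntegrableOn (fun t => G t * ((Dl (1 - Real.exp (-t)) ^ j : ℝ) : ℂ))
      (Ioi 0) := fun j => bdd_int hs _ (Dl 1 ^ j) (cC.pow j) fun t ht => by
        rw [abs_pow]; exact pow_le_pow_left₀ (abs_nonneg _) (bC ht) j
  have iR : ∀ j : ℕ, IntegrableOn
      (fun t => G t * (((t * PF t 1) ^ j * PF t 2 ^ (n - j) : ℝ) : ℂ)) (Ioi 0) :=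
    fun j => bdd_int hs _ ((3 * Dl 1) ^ j * Dl 1 ^ (n - j)) ((cB.pow j).mul (cA.pow _))
      fun t ht => by
        rw [abs_mul, abs_pow, abs_pow]
        have := bB ht
        have := bA ht
        have := (abs_nonneg _).trans (bB ht)
        gcongr
  calc _ = (1 / Complex.Gamma s) * ∑ j ∈ Finset.range (n + 1), ∫ t in Ioi (0:ℝ),
        ((n.choose j : ℂ) * (-1) ^ j * (riemannZeta 2) ^ (n - j)) *
          (G t * ((Dl (1 - Real.exp (-t)) ^ j : ℝ) : ℂ)) := by
        rw [Finset.mul_sum]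
        refine Finset.sum_congr rfl fun j _ => ?_
        rw [hxi, integral_const_mul]
        ring
    _ = (1 / Complex.Gamma s) * ∑ j ∈ Finset.range (n + 1), ∫ t in Ioi (0:ℝ),
        (n.choose j : ℂ) * (G t * (((t * PF t 1) ^ j * PF t 2 ^ (n - j) : ℝ) : ℂ)) := by
        congr 1
        rw [← integral_finsetSum _ fun j _ => (iL j).const_mul _,
          ← integral_finsetSum _ fun j _ => (iR j).const_mul _]
        refine setIntegral_congr_fun measurableSet_Ioi fun t ht => ?_
        have e : ((t * PF t 1 + PF t 2 : ℝ) : ℂ) ^ n =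
          ((-Dl (1 - Real.exp (-t)) + Dl 1 : ℝ) : ℂ) ^ n := by rw [refl' ht]
        rw [Complex.ofReal_add, Complex.ofReal_add, add_pow, add_pow] at e
        have e2 := congrArg (fun z => G t * z) e.symm
        simp only [Finset.mul_sum] at e2
        convert e2 using 1
        · refine Finset.sum_congr rfl fun j _ => ?_
          rw [zeta_two_eq]
          rw [Complex.ofReal_neg, neg_pow ((Dl (1 - Real.exp (-t)) : ℝ) : ℂ), Complex.ofReal_pow]
          ring
        · refine Finset.sum_congr rfl fun j _ => ?_
          push_cast
          ring
    _ = _ := by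
        rw [Finset.mul_sum]
        refine Finset.sum_congr rfl fun j hj => ?_
        rw [mul_assoc, hz j hj, integral_const_mul]
        ring

theorem stmt_14 (r : ℕ) (hr : 1 ≤ r) (s : ℂ) (hs : 1 < s.re) :
    (∑ j ∈ Finset.range r,
        ((r - 1).choose j : ℂ) * (-1) ^ j * (riemannZeta 2) ^ (r - 1 - j) *
          xiMT j (fun _ => 2) s) =
      ∑ j ∈ Finset.range r,
        ((r - 1).choose j : ℂ) * (∏ i ∈ Finset.range j, (s + (i : ℂ))) *
          zMTm r
            (fun i => if (i : ℕ) < r - 1 - j then 2 else if (i : ℕ) < r - 1 then 1 else 0)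
            (s + (j : ℂ)) := by
  obtain ⟨n, rfl⟩ := Nat.exists_eq_add_of_le' hr
  exact main n s hs
end

section
/- The identity ζ(2)²·ζ(m+1) − 2ζ(2)·(1/m!)·ζ_{MT,m+1}(2,1,...,1;1) + (1/m!)·ζ_{MT,m+2}(2,2,1,...,1;1) = ζ_{MT,3}(2,2,0;m+1) + 2(m+1)·ζ_{MT,3}(2,1,0;m+2) + (m+1)(m+2)·ζ_{MT,3}(1,1,0;m+3) holds for every integer m ≥ 3, where on the left there are m ones in each MT value. -/
open scoped BigOperators

open MeasureTheory Set

namespace MTproof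

/-- The sum defining `zMTn`, valued in the extended nonnegative reals. -/
noncomputable def ZE (r : ℕ) (a : Fin r → ℕ) (c : ℕ) : ENNReal :=
  ∑' m : Fin r → ℕ+,
    ENNReal.ofReal (1 / ((∏ j, ((m j : ℕ) : ℝ) ^ (a j)) * (((∑ j, (m j : ℕ)) : ℕ) : ℝ) ^ c))

/-- The Riemann zeta value, valued in the extended nonnegative reals. -/
noncomputable def zE (k : ℕ) : ENNReal := ∑' n : ℕ+, ENNReal.ofReal (1 / ((n : ℕ) : ℝ) ^ k)

/-- `Li_k (exp (-t))`. -/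
noncomputable def ell (k : ℕ) (t : ℝ) : ENNReal :=
  ∑' n : ℕ+, ENNReal.ofReal (Real.exp (-(((n : ℕ) : ℝ) * t)) / ((n : ℕ) : ℝ) ^ k)

/-- The involution `-log (1 - exp (-t))`. -/
noncomputable def phi (t : ℝ) : ℝ := -Real.log (1 - Real.exp (-t))

lemma zMTn_eq (r : ℕ) (a : Fin r → ℕ) (c : ℕ) : zMTn r a c = ((ZE r a c).toReal : ℂ) := by
  unfold zMTn ZE
  rw [ENNReal.tsum_toReal_eq (fun _ => ENNReal.ofReal_ne_top), Complex.ofReal_tsum]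
  refine tsum_congr fun m => ?_
  rw [ENNReal.toReal_ofReal (by positivity)]
  push_cast
  rfl

lemma zeta_eq (k : ℕ) (hk : 1 < k) : riemannZeta k = ((zE k).toReal : ℂ) := by
  unfold zE
  rw [ENNReal.tsum_toReal_eq (fun _ => ENNReal.ofReal_ne_top), Complex.ofReal_tsum,
    zeta_nat_eq_tsum_of_gt_one hk,
    ← tsum_pnat_eq_tsum_of_eq_zero (f := fun n : ℕ => 1 / (n : ℂ) ^ k) (by simp; omega)]
  refine tsum_congr fun m => ?_
  rw [ENNReal.toReal_ofReal (by positivity)]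
  push_cast
  rfl

lemma zE_ne_top (k : ℕ) (hk : 1 < k) : zE k ≠ ⊤ := by
  unfold zE
  have h : Summable (fun n : ℕ => 1 / (n : ℝ) ^ k) := Real.summable_one_div_nat_pow.mpr hk
  have h2 : Summable (fun n : ℕ+ => 1 / ((n : ℕ) : ℝ) ^ k) := h.comp_injective PNat.coe_injective
  rw [← ENNReal.ofReal_tsum_of_nonneg (fun n => by positivity) h2]
  exact ENNReal.ofReal_ne_top

lemma tsum_pi_prod (r : ℕ) (f : Fin r → ℕ+ → ENNReal) :
    ∑' m : Fin r → ℕ+, ∏ j, f j (m j) = ∏ j, ∑' n, f j n := by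
  induction r with
  | zero => simp
  | succ r ih =>
    rw [← (Fin.consEquiv (fun _ : Fin (r + 1) => ℕ+)).tsum_eq]
    rw [Fin.prod_univ_succ, ← ih]
    simp only [Fin.consEquiv, Equiv.coe_fn_mk, Fin.prod_univ_succ, Fin.cons_zero, Fin.cons_succ]
    rw [ENNReal.tsum_prod (f := fun a (b : Fin r → ℕ+) => f 0 a * ∏ j : Fin r, f j.succ (b j))]
    simp only [ENNReal.tsum_mul_left, ENNReal.tsum_mul_right]

lemma gamma_int (k : ℕ) (N : ℝ) (hN : 0 < N) :
    ∫⁻ t in Ioi (0 : ℝ), ENNReal.ofReal (t ^ k * Real.exp (-(N * t)))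
      = ENNReal.ofReal (k.factorial * (1 / N ^ (k + 1))) := by
  have h := Real.integral_rpow_mul_exp_neg_mul_Ioi (a := (k : ℝ) + 1) (r := N) (by positivity) hN
  have h2 : ∫ t in Ioi (0 : ℝ), t ^ k * Real.exp (-(N * t)) = k.factorial * (1 / N ^ (k + 1)) := by
    rw [Real.Gamma_nat_eq_factorial] at h
    simp only [add_sub_cancel_right, Real.rpow_natCast] at h
    rw [h, mul_comm]
    congr 1
    rw [← Nat.cast_add_one, Real.rpow_natCast, div_pow, one_pow]
  rw [← h2]
  symm
  apply ofReal_integral_eq_lintegral_ofReal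
  · apply Integrable.of_integral_ne_zero
    rw [h2]; positivity
  · filter_upwards [ae_restrict_mem measurableSet_Ioi] with t ht
    have : (0 : ℝ) < t := ht
    simp only [Pi.zero_apply]; positivity

lemma ell_meas (k : ℕ) : Measurable (ell k) := by
  unfold ell
  fun_prop

lemma ZE_int (r : ℕ) (a : Fin (r + 1) → ℕ) (k : ℕ) :
    (k.factorial : ENNReal) * ZE (r + 1) a (k + 1)
      = ∫⁻ t in Ioi (0 : ℝ), ENNReal.ofReal (t ^ k) * ∏ j, ell (a j) t := by
  unfold ell ZE
  simp_rw [← tsum_pi_prod, ← ENNReal.tsum_mul_left]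
  rw [lintegral_tsum (fun m => by fun_prop)]
  refine tsum_congr fun m => ?_
  have hN : (0 : ℝ) < (((∑ j, (m j : ℕ)) : ℕ) : ℝ) := by
    rw [Nat.cast_pos]
    exact Finset.sum_pos (fun i _ => (m i).pos) ⟨0, Finset.mem_univ _⟩
  have hP : (0 : ℝ) < ∏ j, ((m j : ℕ) : ℝ) ^ (a j) :=
    Finset.prod_pos fun j _ => pow_pos (by exact_mod_cast (m j).pos) _
  have h1 : ∀ t ∈ Ioi (0 : ℝ), ENNReal.ofReal (t ^ k) *
      ∏ j, ENNReal.ofReal (Real.exp (-(((m j : ℕ) : ℝ) * t)) / ((m j : ℕ) : ℝ) ^ (a j))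
      = ENNReal.ofReal (1 / ∏ j, ((m j : ℕ) : ℝ) ^ (a j)) *
        ENNReal.ofReal (t ^ k * Real.exp (-((((∑ j, (m j : ℕ)) : ℕ) : ℝ) * t))) := by
    intro t ht
    have ht' : (0 : ℝ) < t := ht
    rw [← ENNReal.ofReal_prod_of_nonneg (fun j _ => by positivity),
      ← ENNReal.ofReal_mul (by positivity), ← ENNReal.ofReal_mul (by positivity)]
    congr 1
    rw [Finset.prod_div_distrib, ← Real.exp_sum]
    push_cast
    rw [Finset.sum_neg_distrib, Finset.sum_mul]
    ring
  rw [setLIntegral_congr_fun measurableSet_Ioi h1, lintegral_const_mul _ (by fun_prop),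
    gamma_int _ _ hN, ← ENNReal.ofReal_mul (by positivity),
    ← ENNReal.ofReal_natCast, ← ENNReal.ofReal_mul (by positivity)]
  congr 1
  field_simp

lemma zE_int (k : ℕ) :
    (k.factorial : ENNReal) * zE (k + 1) = ∫⁻ t in Ioi (0 : ℝ), ENNReal.ofReal (t ^ k) * ell 0 t := by
  have h := ZE_int 0 (fun _ => 0) k
  simp only [Fin.prod_univ_succ, Fin.prod_univ_zero, mul_one] at h
  rw [← h]
  congr 1
  unfold zE ZE
  rw [← (Equiv.funUnique (Fin 1) ℕ+).symm.tsum_eq]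
  refine tsum_congr fun n => ?_
  simp

lemma exp_lt {t : ℝ} (ht : 0 < t) : 0 < 1 - Real.exp (-t) := by
  have := Real.exp_lt_exp.2 (show -t < 0 by linarith)
  rw [Real.exp_zero] at this
  linarith

lemma exp_phi {t : ℝ} (ht : 0 < t) : Real.exp (-phi t) = 1 - Real.exp (-t) := by
  unfold phi
  rw [neg_neg, Real.exp_log (exp_lt ht)]

lemma phi_pos {t : ℝ} (ht : 0 < t) : 0 < phi t := by
  unfold phi
  have := Real.log_neg (exp_lt ht) (by linarith [Real.exp_pos (-t)])
  linarith

lemma phi_phi {t : ℝ} (ht : 0 < t) : phi (phi t) = t := by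
  rw [phi, exp_phi ht]
  simp

lemma lt_phi {u v : ℝ} (hu : 0 < u) : v < phi u ↔ 1 < Real.exp (-v) + Real.exp (-u) := by
  rw [← neg_lt_neg_iff, ← Real.exp_lt_exp, exp_phi hu]
  constructor <;> intro h <;> linarith

lemma lt_phi_symm {u v : ℝ} (hu : 0 < u) (hv : 0 < v) : v < phi u ↔ u < phi v := by
  rw [lt_phi hu, lt_phi hv, add_comm]

lemma phi_meas : Measurable phi := by
  unfold phi
  fun_prop

lemma ell_zero {t : ℝ} (ht : 0 < t) :
    ell 0 t = ENNReal.ofReal (Real.exp (-t) / (1 - Real.exp (-t))) := by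
  have h := (hasSum_geometric_of_lt_one (Real.exp_pos (-t)).le
    (by linarith [exp_lt ht])).mul_left (Real.exp (-t))
  rw [div_eq_mul_inv, ← h.tsum_eq, ENNReal.ofReal_tsum_of_nonneg (fun n => by positivity) h.summable]
  unfold ell
  rw [tsum_pnat_eq_tsum_succ
    (f := fun n : ℕ => ENNReal.ofReal (Real.exp (-((n : ℝ) * t)) / (n : ℝ) ^ 0))]
  refine tsum_congr fun n => ?_
  congr 1
  rw [← Real.exp_nat_mul, ← Real.exp_add]
  push_cast
  rw [pow_zero, div_one]
  congr 1
  ring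

lemma ell_one {t : ℝ} (ht : 0 < t) : ell 1 t = ENNReal.ofReal (phi t) := by
  have h := Real.hasSum_pow_div_log_of_abs_lt_one (x := Real.exp (-t))
    (by rw [abs_of_pos (Real.exp_pos _)]; linarith [exp_lt ht])
  rw [phi, ← h.tsum_eq, ENNReal.ofReal_tsum_of_nonneg (fun n => by positivity) h.summable]
  unfold ell
  rw [tsum_pnat_eq_tsum_succ
    (f := fun n : ℕ => ENNReal.ofReal (Real.exp (-((n : ℝ) * t)) / (n : ℝ) ^ 1))]
  refine tsum_congr fun n => ?_
  congr 1
  rw [← Real.exp_nat_mul]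
  push_cast
  rw [pow_one]
  congr 2
  ring

lemma exp_int (N : ℝ) (hN : 0 < N) (c : ℝ) :
    ∫⁻ t in Ioi c, ENNReal.ofReal (Real.exp (-(N * t))) = ENNReal.ofReal (Real.exp (-(N * c)) / N) := by
  have h := integral_exp_mul_Ioi (a := -N) (by linarith) c
  have hi := integrableOn_exp_mul_Ioi (a := -N) (by linarith) c
  rw [neg_div_neg_eq] at h
  simp only [neg_mul] at h hi
  rw [← h]
  symm
  exact ofReal_integral_eq_lintegral_ofReal hi (ae_of_all _ fun t => (Real.exp_pos _).le)

lemma ell_two_int {c : ℝ} (hc : 0 ≤ c) :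
    ∫⁻ t in Ioi c, ENNReal.ofReal (phi t) = ell 2 c := by
  have h1 : ∀ t ∈ Ioi c, ENNReal.ofReal (phi t) = ell 1 t := fun t ht =>
    (ell_one (lt_of_le_of_lt hc ht)).symm
  rw [setLIntegral_congr_fun measurableSet_Ioi h1]
  unfold ell
  rw [lintegral_tsum (fun m => by fun_prop)]
  refine tsum_congr fun n => ?_
  have hn : (0 : ℝ) < ((n : ℕ) : ℝ) := by exact_mod_cast n.pos
  simp_rw [div_eq_mul_inv, ENNReal.ofReal_mul (Real.exp_pos _).le]
  rw [lintegral_mul_const _ (by fun_prop), exp_int _ hn, ← ENNReal.ofReal_mul (by positivity),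
    ← ENNReal.ofReal_mul (by positivity)]
  congr 1
  field_simp

lemma ell_two_zero : ell 2 0 = zE 2 := by
  unfold ell zE
  simp

lemma reflection {t : ℝ} (ht : 0 < t) :
    ell 2 (phi t) + (ell 2 t + ENNReal.ofReal t * ell 1 t) = zE 2 := by
  have hpt := phi_pos ht
  rw [← ell_two_zero, ← ell_two_int le_rfl, ← Ioc_union_Ioi_eq_Ioi ht.le,
    lintegral_union measurableSet_Ioi (Ioc_disjoint_Ioi le_rfl), ell_two_int ht.le]
  have key : ∫⁻ u in Ioc 0 t, ENNReal.ofReal (phi u)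
      = ENNReal.ofReal t * ell 1 t + ell 2 (phi t) := by
    have h1 : ∀ u ∈ Ioc 0 t, ENNReal.ofReal (phi u)
        = ∫⁻ v in Ioi (0 : ℝ), ({p : ℝ × ℝ | p.2 < phi p.1}.indicator 1 (u, v) : ENNReal) := by
      intro u hu
      have : ∀ v : ℝ, ({p : ℝ × ℝ | p.2 < phi p.1}.indicator 1 (u, v) : ENNReal)
          = (Iio (phi u)).indicator 1 v := fun v => by
        simp [indicator_apply]
      simp_rw [this]
      rw [lintegral_indicator_one measurableSet_Iio, Measure.restrict_apply measurableSet_Iio,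
        Iio_inter_Ioi, Real.volume_Ioo, sub_zero]
    have hms : MeasurableSet {p : ℝ × ℝ | p.2 < phi p.1} :=
      measurableSet_lt measurable_snd (phi_meas.comp measurable_fst)
    rw [setLIntegral_congr_fun measurableSet_Ioc h1, lintegral_lintegral_swap
      (f := fun u v => ({p : ℝ × ℝ | p.2 < phi p.1}.indicator 1 (u, v) : ENNReal))
      (((measurable_const (a := (1 : ENNReal))).indicator hms).aemeasurable)]
    have h2 : ∀ v ∈ Ioi (0 : ℝ),
        ∫⁻ u in Ioc 0 t, ({p : ℝ × ℝ | p.2 < phi p.1}.indicator 1 (u, v) : ENNReal)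
        = min (ENNReal.ofReal t) (ENNReal.ofReal (phi v)) := by
      intro v hv
      have : ∀ u ∈ Ioc 0 t, ({p : ℝ × ℝ | p.2 < phi p.1}.indicator 1 (u, v) : ENNReal)
          = (Iio (phi v)).indicator 1 u := fun u hu => by
        simp [indicator_apply, lt_phi_symm hu.1 hv]
      rw [setLIntegral_congr_fun measurableSet_Ioc this,
        setLIntegral_congr Ioo_ae_eq_Ioc.symm,
        lintegral_indicator_one measurableSet_Iio, Measure.restrict_apply measurableSet_Iio,
        inter_comm, Ioo_inter_Iio, Real.volume_Ioo, sub_zero,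
        ENNReal.ofReal_min]
    rw [setLIntegral_congr_fun measurableSet_Ioi h2, ← Ioc_union_Ioi_eq_Ioi hpt.le,
      lintegral_union measurableSet_Ioi (Ioc_disjoint_Ioi le_rfl), ell_one ht]
    congr 1
    · have h3 : ∀ v ∈ Ioc 0 (phi t), min (ENNReal.ofReal t) (ENNReal.ofReal (phi v))
          = ENNReal.ofReal t := by
        intro v hv
        apply min_eq_left
        apply ENNReal.ofReal_le_ofReal
        by_contra hcon
        push Not at hcon
        have h4 := (lt_phi_symm (u := phi t) (v := phi v) hpt (phi_pos hv.1)).1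
          (by rwa [phi_phi ht])
        rw [phi_phi hv.1] at h4
        exact absurd h4 (not_lt.2 hv.2)
      rw [setLIntegral_congr_fun measurableSet_Ioc h3]
      simp
    · rw [← ell_two_int hpt.le]
      refine setLIntegral_congr_fun measurableSet_Ioi fun v hv => ?_
      apply min_eq_right
      apply ENNReal.ofReal_le_ofReal
      by_contra hcon
      push Not at hcon
      have hv0 : 0 < v := hpt.trans hv
      exact absurd ((lt_phi_symm hv0 ht).1 hcon) (not_lt.2 (le_of_lt hv))
  rw [key]
  ring

lemma phi_deriv {t : ℝ} (ht : 0 < t) :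
    HasDerivAt phi (-(Real.exp (-t) / (1 - Real.exp (-t)))) t := by
  unfold phi
  have h := (((hasDerivAt_neg t).exp.const_sub 1).log (exp_lt ht).ne').neg
  refine h.congr_deriv ?_
  ring

lemma change_var (F : ℝ → ENNReal) :
    ∫⁻ t in Ioi (0 : ℝ), F t = ∫⁻ t in Ioi (0 : ℝ), ell 0 t * F (phi t) := by
  have him : phi '' Ioi 0 = Ioi 0 := by
    ext x
    constructor
    · rintro ⟨t, ht, rfl⟩
      exact phi_pos ht
    · intro hx
      exact ⟨phi x, phi_pos hx, phi_phi hx⟩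
  have hinj : InjOn phi (Ioi 0) := by
    intro x hx y hy h
    rw [← phi_phi hx, h, phi_phi hy]
  have h := lintegral_image_eq_lintegral_abs_deriv_mul measurableSet_Ioi
    (fun t ht => (phi_deriv ht).hasDerivWithinAt) hinj F
  rw [him] at h
  rw [h]
  refine setLIntegral_congr_fun measurableSet_Ioi fun t ht => ?_
  have := exp_lt ht
  beta_reduce
  rw [ell_zero ht, abs_neg, abs_of_pos (by positivity)]

end MTproof

namespace MTproof

lemma pointwise {t : ℝ} (ht : 0 < t) :
    (ell 2 t + ENNReal.ofReal t * ell 1 t) ^ 2 + 2 * zE 2 * ell 2 (phi t)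
      = zE 2 ^ 2 + ell 2 (phi t) ^ 2 := by
  rw [← reflection ht]
  ring

lemma phi_comp_meas (k : ℕ) : Measurable fun t => ell k (phi t) := (ell_meas k).comp phi_meas

/-- The weighted integral in which all terms of the identity are expressed. -/
noncomputable def II (m : ℕ) (F : ℝ → ENNReal) : ENNReal :=
  ∫⁻ t in Ioi (0 : ℝ), ENNReal.ofReal (t ^ m) * ell 0 t * F t

lemma wmeas (m : ℕ) : Measurable fun t : ℝ => ENNReal.ofReal (t ^ m) * ell 0 t := by
  have := ell_meas 0
  fun_prop

lemma II_add (m : ℕ) (F G : ℝ → ENNReal) (hF : Measurable F) :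
    II m (fun t => F t + G t) = II m F + II m G := by
  unfold II
  simp_rw [mul_add]
  exact lintegral_add_left ((wmeas m).mul hF) _

lemma II_const_mul (m : ℕ) (c : ENNReal) (F : ℝ → ENNReal) (hF : Measurable F) :
    II m (fun t => c * F t) = c * II m F := by
  unfold II
  refine Eq.trans ?_ (lintegral_const_mul c ((wmeas m).mul hF))
  refine lintegral_congr fun t => ?_
  simp only [Pi.mul_apply]
  ring

lemma II_congr (m : ℕ) (F G : ℝ → ENNReal) (h : ∀ t, 0 < t → F t = G t) : II m F = II m G := by
  unfold II
  refine setLIntegral_congr_fun measurableSet_Ioi fun t ht => ?_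
  beta_reduce
  rw [h t ht]

lemma II_mono (m : ℕ) (F G : ℝ → ENNReal) (h : ∀ t, 0 < t → F t ≤ G t) : II m F ≤ II m G := by
  unfold II
  refine setLIntegral_mono_ae' measurableSet_Ioi (ae_of_all _ fun t ht => ?_)
  have := h t ht
  gcongr

lemma I_zeta (m : ℕ) : (m.factorial : ENNReal) * zE (m + 1) = II m (fun _ => 1) := by
  rw [zE_int]; simp [II]

lemma I_T1 (m : ℕ) : ZE (m + 1) (Fin.cons 2 fun _ : Fin m => 1) 1
    = II m (fun t => ell 2 (phi t)) := by
  have h := ZE_int m (Fin.cons 2 fun _ : Fin m => 1) 0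
  simp only [Nat.factorial_zero, Nat.cast_one, one_mul, zero_add, pow_zero, ENNReal.ofReal_one,
    Fin.prod_univ_succ, Fin.cons_zero, Fin.cons_succ, Finset.prod_const, Finset.card_univ,
    Fintype.card_fin] at h
  rw [h, change_var]
  refine setLIntegral_congr_fun measurableSet_Ioi fun t ht => ?_
  have ht' : (0 : ℝ) < t := ht
  beta_reduce
  rw [ell_one (phi_pos ht), phi_phi ht, ENNReal.ofReal_pow ht'.le]
  ring

lemma I_T2 (m : ℕ) : ZE (m + 2) (Fin.cons 2 (Fin.cons 2 fun _ : Fin m => 1)) 1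
    = II m (fun t => ell 2 (phi t) ^ 2) := by
  have h := ZE_int (m + 1) (Fin.cons 2 (Fin.cons 2 fun _ : Fin m => 1)) 0
  simp only [Nat.factorial_zero, Nat.cast_one, one_mul, zero_add, pow_zero, ENNReal.ofReal_one,
    Fin.prod_univ_succ, Fin.cons_zero, Fin.cons_succ, Finset.prod_const, Finset.card_univ,
    Fintype.card_fin] at h
  rw [h, change_var]
  refine setLIntegral_congr_fun measurableSet_Ioi fun t ht => ?_
  have ht' : (0 : ℝ) < t := ht
  beta_reduce
  rw [ell_one (phi_pos ht), phi_phi ht, ENNReal.ofReal_pow ht'.le]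
  ring

lemma I_R (m i a b : ℕ) : ((m + i).factorial : ENNReal) * ZE 3 ![a, b, 0] (m + i + 1)
    = II m (fun t => ENNReal.ofReal t ^ i * ell a t * ell b t) := by
  rw [ZE_int 2]
  refine setLIntegral_congr_fun measurableSet_Ioi fun t ht => ?_
  have ht' : (0 : ℝ) < t := ht
  have hp : ∏ j, ell ((![a, b, 0] : Fin 3 → ℕ) j) t = ell a t * ell b t * ell 0 t :=
    Fin.prod_univ_three _
  change _ * ∏ j, ell ((![a, b, 0] : Fin 3 → ℕ) j) t = _
  rw [hp]
  rw [pow_add, ENNReal.ofReal_mul (by positivity), ENNReal.ofReal_pow ht'.le i]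
  ring

lemma main_E (m : ℕ) :
    (m.factorial : ENNReal) * ZE 3 ![2, 2, 0] (m + 1)
      + 2 * (((m + 1).factorial : ENNReal) * ZE 3 ![2, 1, 0] (m + 2))
      + ((m + 2).factorial : ENNReal) * ZE 3 ![1, 1, 0] (m + 3)
      + 2 * zE 2 * ZE (m + 1) (Fin.cons 2 fun _ : Fin m => 1) 1
    = zE 2 ^ 2 * ((m.factorial : ENNReal) * zE (m + 1))
      + ZE (m + 2) (Fin.cons 2 (Fin.cons 2 fun _ : Fin m => 1)) 1 := by
  have e1 := ell_meas 1
  have e2 := ell_meas 2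
  have e3 := phi_comp_meas 2
  have h0 := I_R m 0 2 2
  have h1 := I_R m 1 2 1
  have h2 := I_R m 2 1 1
  simp only [add_zero] at h0
  rw [h0, h1, h2, I_T1, I_T2, I_zeta, ← II_const_mul _ _ _ (by fun_prop),
    ← II_const_mul _ _ _ (by fun_prop), ← II_const_mul _ _ _ (by fun_prop),
    ← II_add _ _ _ (by fun_prop), ← II_add _ _ _ (by fun_prop),
    ← II_add _ _ _ (by fun_prop), ← II_add _ _ _ (by fun_prop)]
  refine II_congr _ _ _ fun t ht => ?_
  rw [mul_one, ← pointwise ht]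
  ring

lemma le_zE {t : ℝ} (ht : 0 < t) : ell 2 (phi t) ≤ zE 2 := by
  rw [← reflection ht]
  exact le_self_add

lemma T1_fin (m : ℕ) (hm : 1 ≤ m) : ZE (m + 1) (Fin.cons 2 fun _ : Fin m => 1) 1 ≠ ⊤ := by
  rw [I_T1]
  refine ne_top_of_le_ne_top ?_ (II_mono m _ (fun _ => zE 2 * 1)
    (fun t ht => by rw [mul_one]; exact le_zE ht))
  rw [II_const_mul _ _ _ measurable_const, ← I_zeta]
  exact ENNReal.mul_ne_top (zE_ne_top 2 (by norm_num))
    (ENNReal.mul_ne_top (ENNReal.natCast_ne_top _) (zE_ne_top _ (by omega)))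

lemma T2_fin (m : ℕ) (hm : 1 ≤ m) :
    ZE (m + 2) (Fin.cons 2 (Fin.cons 2 fun _ : Fin m => 1)) 1 ≠ ⊤ := by
  rw [I_T2]
  refine ne_top_of_le_ne_top ?_ (II_mono m _ (fun _ => zE 2 ^ 2 * 1)
    (fun t ht => by rw [mul_one]; have := le_zE ht; gcongr))
  rw [II_const_mul _ _ _ measurable_const, ← I_zeta]
  exact ENNReal.mul_ne_top (ENNReal.pow_ne_top (zE_ne_top 2 (by norm_num)))
    (ENNReal.mul_ne_top (ENNReal.natCast_ne_top _) (zE_ne_top _ (by omega)))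

lemma main_R (m : ℕ) (hm : 1 ≤ m) :
    (m.factorial : ℝ) * (ZE 3 ![2, 2, 0] (m + 1)).toReal
      + 2 * (((m + 1).factorial : ℝ) * (ZE 3 ![2, 1, 0] (m + 2)).toReal)
      + ((m + 2).factorial : ℝ) * (ZE 3 ![1, 1, 0] (m + 3)).toReal
      + 2 * (zE 2).toReal * (ZE (m + 1) (Fin.cons 2 fun _ : Fin m => 1) 1).toReal
    = (zE 2).toReal ^ 2 * ((m.factorial : ℝ) * (zE (m + 1)).toReal)
      + (ZE (m + 2) (Fin.cons 2 (Fin.cons 2 fun _ : Fin m => 1)) 1).toReal := by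
  have h := main_E m
  have hR : zE 2 ^ 2 * ((m.factorial : ENNReal) * zE (m + 1)) ≠ ⊤ :=
    ENNReal.mul_ne_top (ENNReal.pow_ne_top (zE_ne_top 2 (by norm_num)))
      (ENNReal.mul_ne_top (ENNReal.natCast_ne_top _) (zE_ne_top _ (by omega)))
  have hT2 := T2_fin m hm
  have hL := h ▸ ENNReal.add_ne_top.2 ⟨hR, hT2⟩
  obtain ⟨hL1, hb⟩ := ENNReal.add_ne_top.1 hL
  obtain ⟨hL2, hc⟩ := ENNReal.add_ne_top.1 hL1
  obtain ⟨hL3, hd⟩ := ENNReal.add_ne_top.1 hL2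
  have h' := congrArg ENNReal.toReal h
  rw [ENNReal.toReal_add hL1 hb, ENNReal.toReal_add hL2 hc, ENNReal.toReal_add hL3 hd,
    ENNReal.toReal_add hR hT2] at h'
  simpa only [ENNReal.toReal_mul, ENNReal.toReal_pow, ENNReal.toReal_natCast,
    ENNReal.toReal_ofNat] using h'

end MTproof

theorem stmt_15 (m : ℕ) (hm : 3 ≤ m) :
    (riemannZeta 2) ^ 2 * riemannZeta (m + 1)
        - 2 * riemannZeta 2 * (1 / (m.factorial : ℂ)) *
            zMTn (m + 1) (Fin.cons 2 fun _ : Fin m => 1) 1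
        + (1 / (m.factorial : ℂ)) *
            zMTn (m + 2) (Fin.cons 2 (Fin.cons 2 fun _ : Fin m => 1)) 1 =
      zMTn 3 ![2, 2, 0] (m + 1)
        + 2 * ((m : ℂ) + 1) * zMTn 3 ![2, 1, 0] (m + 2)
        + ((m : ℂ) + 1) * ((m : ℂ) + 2) * zMTn 3 ![1, 1, 0] (m + 3) := by

  have h := congrArg (fun x : ℝ => (x : ℂ)) (MTproof.main_R m (by omega))
  have z2 : riemannZeta 2 = ((MTproof.zE 2).toReal : ℂ) := by
    have := MTproof.zeta_eq 2 (by norm_num)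
    simpa using this
  have zm : riemannZeta ((m : ℂ) + 1) = ((MTproof.zE (m + 1)).toReal : ℂ) := by
    have := MTproof.zeta_eq (m + 1) (by omega)
    simpa using this
  simp only [MTproof.zMTn_eq, z2, zm]
  have hf : (m.factorial : ℂ) ≠ 0 := by exact_mod_cast m.factorial_ne_zero
  simp only [Nat.factorial_succ] at h
  push_cast at h
  field_simp
  linear_combination -h
end
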